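/- Corollary 4. Suppose r = p = 2, i.e., both the smallest CN minimum distance and the smallest VN minimum distance equal 2. Then the growth rate of the weight distribution satisfies G(alpha) = alpha log( 1 / P^{-1}(1/C) ) + O(alpha^xi), where P(x) = 2 sum_{t in X_v} (lambda_t/q_t) sum_{i in L_t} B_{i,2}^{(t)} x^i, C = 2 sum_{t in X_c} rho_t A_2^{(t)}/s_t, and xi = min{rbar/2, pbar/2, 2}. -/

import Mathlib

open Filter Polynomial Finset
open scoped Classical

/-- An irregular doubly-generalized LDPC (D-GLDPC) code ensemble, specified by:
check-node (CN) types `Fin nc` with lengths `s`, dimensions `hdim`, minimum distances `rd`,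
weight enumerator coefficients `A`; variable-node (VN) types `Fin nv` with dimensions `kdim`,
lengths `q`, minimum distances `pd`, input-output weight enumerator coefficients `B`;
and edge fractions `ρ` (CN side) and `lam` (VN side). -/
structure DGLDPC where
  nc : ℕ
  nv : ℕ
  hnc : 0 < nc
  hnv : 0 < nv
  s : Fin nc → ℕ
  hdim : Fin nc → ℕ
  rd : Fin nc → ℕ
  A : Fin nc → ℕ → ℕ
  kdim : Fin nv → ℕ
  q : Fin nv → ℕ
  pd : Fin nv → ℕ
  B : Fin nv → ℕ → ℕ → ℕ
  ρ : Fin nc → ℝ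
  lam : Fin nv → ℝ
  h_hdim : ∀ t, 1 ≤ hdim t
  h_hs : ∀ t, hdim t < s t
  h_rd2 : ∀ t, 2 ≤ rd t
  h_rds : ∀ t, rd t ≤ s t
  hA0 : ∀ t, A t 0 = 1
  hAsupp : ∀ t u, u ≠ 0 → (u < rd t ∨ s t < u) → A t u = 0
  hAr : ∀ t, 0 < A t (rd t)
  h_k1 : ∀ t, 1 ≤ kdim t
  h_q1 : ∀ t, 1 ≤ q t
  h_pd2 : ∀ t, 2 ≤ pd t
  h_pdq : ∀ t, pd t ≤ q t
  hB00 : ∀ t, B t 0 0 = 1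
  hBsupp : ∀ t u v, ¬(u = 0 ∧ v = 0) →
    ¬(1 ≤ u ∧ u ≤ kdim t ∧ pd t ≤ v ∧ v ≤ q t) → B t u v = 0
  hBp : ∀ t, ∃ u, 0 < B t u (pd t)
  hρpos : ∀ t, 0 < ρ t
  hlampos : ∀ t, 0 < lam t
  hρsum : ∑ t, ρ t = 1
  hlamsum : ∑ t, lam t = 1

namespace DGLDPC

variable (M : DGLDPC)

/-- `∫ρ = ∑_t ρ_t / s_t`. -/
noncomputable def intrho : ℝ := ∑ t, M.ρ t / (M.s t : ℝ)

/-- `∫λ = ∑_t λ_t / q_t`. -/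
noncomputable def intlam : ℝ := ∑ t, M.lam t / (M.q t : ℝ)

/-- Fraction `δ_t = λ_t / (q_t ∫λ)` of VNs of type `t`. -/
noncomputable def δfrac (t : Fin M.nv) : ℝ := M.lam t / ((M.q t : ℝ) * M.intlam)

/-- `r`: the smallest CN minimum distance. -/
noncomputable def r : ℕ := sInf (Set.range M.rd)

/-- `p`: the smallest VN minimum distance. -/
noncomputable def p : ℕ := sInf (Set.range M.pd)

/-- `ψ = r/(r-1)`. -/
noncomputable def ψ : ℝ := (M.r : ℝ) / ((M.r : ℝ) - 1)

/-- `C = r ∑_{t ∈ X_c} ρ_t A_r^{(t)} / s_t`, sum over CN types of minimum distance `r`. -/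
noncomputable def Cparam : ℝ :=
  (M.r : ℝ) * ∑ t ∈ Finset.univ.filter (fun t => M.rd t = M.r),
    M.ρ t * (M.A t M.r : ℝ) / (M.s t : ℝ)

/-- `T_{i,j} = (j - ψ)/i`. -/
noncomputable def Tij (i j : ℕ) : ℝ := ((j : ℝ) - M.ψ) / (i : ℝ)

/-- `S⁻`: pairs `(i,j) ≠ (0,0)` with `B_{i,j}^{(t)} > 0` for some VN type `t`. -/
def Sminus : Set (ℕ × ℕ) := {ij | (∃ t, 0 < M.B t ij.1 ij.2) ∧ ij ≠ (0, 0)}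

/-- `T = min_{(i,j) ∈ S⁻} T_{i,j}`. -/
noncomputable def T : ℝ := sInf {x : ℝ | ∃ ij ∈ M.Sminus, x = M.Tij ij.1 ij.2}

/-- The set of candidate exponents whose infimum is
`ξ = min { r̄/r, χ/ψ + 1, 2 }` (terms coming from empty families being dropped):
it contains `2`, the values `i/r` for `i > r` with `A_i^{(t)} > 0` for some `t`
(whose minimum is `r̄/r`), and the values `(T_{i,j} - T) i / ψ + 1` for `(i,j) ∈ S⁻`
with `T_{i,j} > T` (whose minimum is `χ/ψ + 1`). -/
noncomputable def xiSet : Set ℝ :=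
  {2} ∪ {x : ℝ | ∃ i : ℕ, M.r < i ∧ (∃ t, 0 < M.A t i) ∧ x = (i : ℝ) / (M.r : ℝ)}
    ∪ {x : ℝ | ∃ ij ∈ M.Sminus, M.T < M.Tij ij.1 ij.2 ∧
        x = (M.Tij ij.1 ij.2 - M.T) * (ij.1 : ℝ) / M.ψ + 1}

/-- The exponent `ξ = min { r̄/r, χ/ψ + 1, 2 }`. -/
noncomputable def ξexp : ℝ := sInf M.xiSet

/-- The polynomial `Q₁(x)`; the sum effectively ranges over `t ∈ Y_v` and `(i,j) ∈ P_t`,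
i.e. over all `(t,i,j)` with `(i,j) ∈ S_t⁻` and `T_{i,j} = T`. -/
noncomputable def Q1 (x : ℝ) : ℝ :=
  ∑ t, (M.lam t / (M.q t : ℝ)) *
    ∑ i ∈ Finset.range (M.kdim t + 1), ∑ j ∈ Finset.range (M.q t + 1),
      if 0 < M.B t i j ∧ (i, j) ≠ (0, 0) ∧ M.Tij i j = M.T then
        (j : ℝ) * (M.B t i j : ℝ) * M.Cparam ^ ((j : ℝ) / (M.r : ℝ)) *
          (M.intlam / Real.exp 1) ^ ((i : ℝ) * M.T / M.ψ) * x ^ i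
      else 0

/-- The polynomial `Q₂(x)`. -/
noncomputable def Q2 (x : ℝ) : ℝ :=
  ∑ t, (M.lam t / (M.q t : ℝ)) *
    ∑ i ∈ Finset.range (M.kdim t + 1), ∑ j ∈ Finset.range (M.q t + 1),
      if 0 < M.B t i j ∧ (i, j) ≠ (0, 0) ∧ M.Tij i j = M.T then
        (i : ℝ) * (M.B t i j : ℝ) * M.Cparam ^ ((j : ℝ) / (M.r : ℝ)) *
          (M.intlam / Real.exp 1) ^ ((i : ℝ) * M.T / M.ψ) * x ^ i
      else 0

/-- Number of Tanner graph edges, `E = n/∫λ` (exact on admissible `n`). -/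
noncomputable def En (n : ℕ) : ℕ := ⌊(n : ℝ) / M.intlam⌋₊

/-- Number of CNs of type `t`, `γ_t m = E ρ_t / s_t` (exact on admissible `n`). -/
noncomputable def cExp (n : ℕ) (t : Fin M.nc) : ℕ := ⌊(M.En n : ℝ) * M.ρ t / (M.s t : ℝ)⌋₊

/-- Number of VNs of type `t`, `δ_t n = E λ_t / q_t` (exact on admissible `n`). -/
noncomputable def vExp (n : ℕ) (t : Fin M.nv) : ℕ := ⌊(M.En n : ℝ) * M.lam t / (M.q t : ℝ)⌋₊

/-- The CN weight enumerating polynomial `A^{(t)}(x)`. -/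
noncomputable def Apoly (t : Fin M.nc) : Polynomial ℝ :=
  ∑ u ∈ Finset.range (M.s t + 1), Polynomial.C ((M.A t u : ℕ) : ℝ) * Polynomial.X ^ u

/-- The VN bivariate weight enumerating polynomial `B^{(t)}(x,y)`, with the outer
variable recording input weight and the inner variable recording output weight. -/
noncomputable def Bpoly (t : Fin M.nv) : Polynomial (Polynomial ℝ) :=
  ∑ u ∈ Finset.range (M.kdim t + 1),
    Polynomial.C (∑ v ∈ Finset.range (M.q t + 1),
      Polynomial.C ((M.B t u v : ℕ) : ℝ) * Polynomial.X ^ v) * Polynomial.X ^ u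

/-- `N_c(v)`: the number of check-valid assignments of weight `v`, i.e. the coefficient
of `x^v` in `∏_t (A^{(t)}(x))^{γ_t m}`. -/
noncomputable def NcCount (n v : ℕ) : ℝ := (∏ t, M.Apoly t ^ M.cExp n t).coeff v

/-- `N_v(u,v)`: the coefficient of `x^u y^v` in `∏_t (B^{(t)}(x,y))^{δ_t n}`. -/
noncomputable def NvCount (n u v : ℕ) : ℝ := ((∏ t, M.Bpoly t ^ M.vExp n t).coeff u).coeff v

/-- The expected number of codewords of weight `w`:
`E[N_w] = ∑_v N_v(w,v) N_c(v) / binom(E,v)`. -/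
noncomputable def ENw (n w : ℕ) : ℝ :=
  ∑ v ∈ Finset.range (M.En n + 1),
    M.NvCount n w v * M.NcCount n v / ((M.En n).choose v : ℝ)

/-- `n` is admissible for `α` when all the relevant quantities (`E`, the numbers of
CNs and VNs of each type, and the codeword weight `α n`) are integers and the
expected number of weight-`α n` codewords is positive. -/
def Adm (α : ℝ) (n : ℕ) : Prop :=
  0 < n ∧ ((M.En n : ℝ) = (n : ℝ) / M.intlam) ∧
  (∀ t, (M.cExp n t : ℝ) = (M.En n : ℝ) * M.ρ t / (M.s t : ℝ)) ∧
  (∀ t, (M.vExp n t : ℝ) = (M.En n : ℝ) * M.lam t / (M.q t : ℝ)) ∧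
  ((⌊α * (n : ℝ)⌋₊ : ℝ) = α * (n : ℝ)) ∧
  0 < M.ENw n ⌊α * (n : ℝ)⌋₊

/-- The sequence `(1/n) log E[N_{αn}]` whose limit (along admissible `n`) is `G(α)`. -/
noncomputable def grSeq (α : ℝ) (n : ℕ) : ℝ :=
  (1 / (n : ℝ)) * Real.log (M.ENw n ⌊α * (n : ℝ)⌋₊)

end DGLDPC

namespace DGLDPC

variable (M : DGLDPC)

/-- The polynomial `P(x) = 2 ∑_{t ∈ X_v} (λ_t/q_t) ∑_{i ∈ L_t} B_{i,2}^{(t)} x^i`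
(for the case `r = p = 2`). -/
noncomputable def Pfun (x : ℝ) : ℝ :=
  2 * ∑ t ∈ Finset.univ.filter (fun t => M.pd t = M.p),
    (M.lam t / (M.q t : ℝ)) *
      ∑ i ∈ Finset.range (M.kdim t + 1), (M.B t i 2 : ℝ) * x ^ i

/-- The exponent `ξ = min { r̄/2, p̄/2, 2 }` for the case `r = p = 2`, encoded as the
infimum of the set containing `2`, the values `i/2` for `i > r` with `A_i^{(t)} > 0` for
some `t` (whose minimum is `r̄/2`), and the values `j/2` for `j > p` with `B_{i,j}^{(t)} > 0`
for some `t`, `i` (whose minimum is `p̄/2`). -/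
noncomputable def xiexp2 : ℝ :=
  sInf ({2} ∪ {x : ℝ | ∃ i : ℕ, M.r < i ∧ (∃ t, 0 < M.A t i) ∧ x = (i : ℝ) / 2}
    ∪ {x : ℝ | ∃ j : ℕ, M.p < j ∧ (∃ t i, 0 < M.B t i j) ∧ x = (j : ℝ) / 2})

end DGLDPC

namespace Cor4

/-- coefficientwise order -/
@[reducible] def polyPO (R : Type*) [Semiring R] [PartialOrder R] : PartialOrder R[X] :=
  PartialOrder.lift (fun p => p.coeff) Polynomial.coeff_injective

attribute [local instance] polyPO

theorem polyLe_iff {R : Type*} [Semiring R] [PartialOrder R] {p q : R[X]} :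
    p ≤ q ↔ ∀ i, p.coeff i ≤ q.coeff i := Iff.rfl

theorem polyOR (R : Type*) [CommRing R] [PartialOrder R] [IsOrderedRing R] :
    IsOrderedRing R[X] := by
  have : IsOrderedAddMonoid R[X] := ⟨fun a b h c => by
    rw [polyLe_iff] at *
    intro i
    simp only [coeff_add]
    have := h i
    gcongr, fun a b h c => by
    rw [polyLe_iff] at *
    intro i
    simp only [coeff_add]
    have := h i
    gcongr⟩
  have : ZeroLEOneClass R[X] := ⟨by
    rw [polyLe_iff]; intro i
    simp only [coeff_one, coeff_zero]
    split_ifs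
    · exact zero_le_one
    · exact le_rfl⟩
  apply IsOrderedRing.of_mul_nonneg
  intro a b ha hb
  rw [polyLe_iff] at *
  intro i
  rw [coeff_mul, coeff_zero]
  exact Finset.sum_nonneg fun p _ => mul_nonneg (by simpa using ha p.1) (by simpa using hb p.2)

attribute [local instance] polyOR

section abs
variable {R : Type*} [CommRing R] [PartialOrder R] [IsOrderedRing R] [Algebra ℝ R]

theorem expsum_add (h : ∀ a : ℝ, 0 ≤ a → 0 ≤ algebraMap ℝ R a) (M : ℕ) (x y : R) (hx : 0 ≤ x) (hy : 0 ≤ y) :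
    ∑ m ∈ range (M+1), algebraMap ℝ R (1 / (m.factorial : ℝ)) * (x + y)^m ≤
    (∑ m ∈ range (M+1), algebraMap ℝ R (1 / (m.factorial : ℝ)) * x^m) *
    (∑ m ∈ range (M+1), algebraMap ℝ R (1 / (m.factorial : ℝ)) * y^m) := by
  have key : ∀ m, algebraMap ℝ R (1 / (m.factorial : ℝ)) * (x + y)^m =
      ∑ p ∈ antidiagonal m, (algebraMap ℝ R (1 / (p.1.factorial : ℝ)) * x^p.1) *
        (algebraMap ℝ R (1 / (p.2.factorial : ℝ)) * y^p.2) := by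
    intro m
    rw [(Commute.all x y).add_pow', Finset.mul_sum]
    refine Finset.sum_congr rfl fun p hp => ?_
    rw [HasAntidiagonal.mem_antidiagonal] at hp
    have : (m.choose p.1 : ℝ) = m.factorial / (p.1.factorial * p.2.factorial) := by
      rw [← hp, Nat.choose_symm_add, Nat.add_choose, Nat.cast_div (Nat.factorial_mul_factorial_dvd_factorial_add _ _)]
      · push_cast; rfl
      · positivity
    have h2 : ((m.choose p.1 : ℕ) : R) = algebraMap ℝ R (m.factorial / (p.1.factorial * p.2.factorial)) := by
      rw [← this]; simp
    rw [nsmul_eq_mul, h2]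
    have h3 : (1 / (m.factorial:ℝ)) * (m.factorial / (p.1.factorial * p.2.factorial)) = (1 / (p.1.factorial:ℝ)) * (1 / (p.2.factorial:ℝ)) := by
      have := Nat.factorial_ne_zero m
      field_simp
    have h4 := congrArg (algebraMap ℝ R) h3
    rw [map_mul, map_mul] at h4
    calc _ = (algebraMap ℝ R (1 / (m.factorial:ℝ)) * algebraMap ℝ R (m.factorial / (p.1.factorial * p.2.factorial))) * (x^p.1*y^p.2) := by ring
      _ = _ := by rw [h4]; ring
  simp_rw [key]
  rw [Finset.sum_mul_sum, Finset.sum_sigma', ← Finset.sum_product']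
  set g : ℕ × ℕ → R := fun p => (algebraMap ℝ R (1 / (p.1.factorial : ℝ)) * x^p.1) *
        (algebraMap ℝ R (1 / (p.2.factorial : ℝ)) * y^p.2)
  have hg : ∀ p, 0 ≤ g p := fun p => mul_nonneg
    (mul_nonneg (h _ (by positivity)) (pow_nonneg hx _)) (mul_nonneg (h _ (by positivity)) (pow_nonneg hy _))
  have : ∑ p ∈ (range (M+1)).sigma (fun m => antidiagonal m), g p.2 =
     ∑ p ∈ ((range (M+1)).sigma (fun m => antidiagonal m)).image (fun p => p.2), g p := by
    rw [Finset.sum_image]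
    rintro ⟨a, b⟩ ha ⟨c, d⟩ hc hbd
    simp only [coe_sigma, Set.mem_sigma_iff, Finset.mem_coe, HasAntidiagonal.mem_antidiagonal] at ha hc
    simp only at hbd
    subst hbd
    obtain rfl : a = c := by rw [← ha.2, ← hc.2]
    rfl
  refine this.trans_le ?_
  apply Finset.sum_le_sum_of_subset_of_nonneg
  · intro p hp
    simp only [mem_image, mem_sigma, Finset.mem_range, HasAntidiagonal.mem_antidiagonal, Sigma.exists] at hp
    obtain ⟨a, b, ⟨h1, h2⟩, rfl⟩ := hp
    simp only [Finset.mem_product, Finset.mem_range]; omega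
  · intro p _ _; exact hg p

theorem expsum_single (h : ∀ a : ℝ, 0 ≤ a → 0 ≤ algebraMap ℝ R a) (M v : ℕ) (hM : M ≤ v)
    (c : ℝ) (hc : 0 ≤ c) (hcv : c ≤ v - M) (x : R) (hx : 0 ≤ x) :
    ∑ m ∈ range (M+1), algebraMap ℝ R (1 / (m.factorial : ℝ)) * (algebraMap ℝ R c * x)^m ≤ (1 + x)^v := by
  have hmono : ∀ a b : ℝ, a ≤ b → algebraMap ℝ R a ≤ algebraMap ℝ R b := by
    intro a b hab
    have := h (b - a) (by linarith)
    rw [map_sub] at this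
    exact sub_nonneg.mp this
  rw [add_comm 1 x, add_pow]
  calc _ ≤ ∑ m ∈ range (M+1), x^m * 1^(v-m) * (v.choose m : R) := by
        refine Finset.sum_le_sum fun m hm => ?_
        rw [Finset.mem_range] at hm
        have h1 : c^m ≤ m.factorial * v.choose m := by
          have h2 := Nat.pow_sub_le_descFactorial v m
          rw [Nat.descFactorial_eq_factorial_mul_choose] at h2
          have h3 : (((v+1-m : ℕ) : ℝ))^m ≤ m.factorial * v.choose m := by exact_mod_cast h2
          refine le_trans ?_ h3
          have : ((v+1-m : ℕ):ℝ) = v + 1 - m := by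
            rw [Nat.cast_sub (by omega)]; push_cast; ring
          have h5 : (m:ℝ) ≤ M := by exact_mod_cast (by omega : m ≤ M)
          gcongr
          rw [this]; linarith
        have h2 : 1 / (m.factorial : ℝ) * c^m ≤ v.choose m := by
          rw [one_div, inv_mul_le_iff₀ (by positivity)]; exact h1
        have h3 := hmono _ _ h2
        rw [map_mul, map_pow, map_natCast] at h3
        calc _ = (algebraMap ℝ R (1 / (m.factorial : ℝ)) * algebraMap ℝ R c ^ m) * x^m := by ring
          _ ≤ (v.choose m : R) * x^m := mul_le_mul_of_nonneg_right h3 (pow_nonneg hx m)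
          _ = _ := by ring
    _ ≤ _ := by
        apply Finset.sum_le_sum_of_subset_of_nonneg
        · intro m; simp only [Finset.mem_range]; omega
        · intro m _ _
          rw [one_pow, mul_one]
          exact mul_nonneg (pow_nonneg hx _) (Nat.cast_nonneg _)

theorem expsum_prod {ι : Type*} (h : ∀ a : ℝ, 0 ≤ a → 0 ≤ algebraMap ℝ R a) (M : ℕ) (s : Finset ι)
    (v : ι → ℕ) (hM : ∀ t, M ≤ v t) (c : ι → ℝ) (hc : ∀ t, 0 ≤ c t) (hcv : ∀ t, c t ≤ v t - M)
    (x : ι → R) (hx : ∀ t, 0 ≤ x t) :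
    ∑ m ∈ range (M+1), algebraMap ℝ R (1 / (m.factorial : ℝ)) * (∑ t ∈ s, algebraMap ℝ R (c t) * x t)^m
      ≤ ∏ t ∈ s, (1 + x t)^(v t) := by
  induction s using Finset.induction_on with
  | empty =>
    simp only [Finset.sum_empty, Finset.prod_empty]
    rw [Finset.sum_range_succ']
    simp
  | insert a s ha ih =>
    rw [Finset.sum_insert ha, Finset.prod_insert ha]
    have hn : ∀ t, 0 ≤ algebraMap ℝ R (c t) * x t := fun t => mul_nonneg (h _ (hc t)) (hx t)
    refine (expsum_add h M _ _ (hn a) (Finset.sum_nonneg fun t _ => hn t)).trans ?_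
    refine mul_le_mul (expsum_single h M _ (hM a) _ (hc a) (hcv a) _ (hx a)) ih ?_ ?_
    · exact Finset.sum_nonneg fun m _ => mul_nonneg (h _ (by positivity))
        (pow_nonneg (Finset.sum_nonneg fun t _ => hn t) _)
    · exact pow_nonneg (add_nonneg zero_le_one (hx a)) _

theorem exp_prod {ι : Type*} (h : ∀ a : ℝ, 0 ≤ a → 0 ≤ algebraMap ℝ R a) (M : ℕ) (s : Finset ι)
    (v : ι → ℕ) (hM : ∀ t, M ≤ v t) (c : ι → ℝ) (hc : ∀ t, 0 ≤ c t) (hcv : ∀ t, c t ≤ v t - M)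
    (x : ι → R) (hx : ∀ t, 0 ≤ x t) :
    algebraMap ℝ R (1 / (M.factorial : ℝ)) * (∑ t ∈ s, algebraMap ℝ R (c t) * x t)^M
      ≤ ∏ t ∈ s, (1 + x t)^(v t) := by
  refine le_trans ?_ (expsum_prod h M s v hM c hc hcv x hx)
  refine Finset.single_le_sum (f := fun m => algebraMap ℝ R (1 / (m.factorial : ℝ)) * (∑ t ∈ s, algebraMap ℝ R (c t) * x t)^m) ?_ (Finset.self_mem_range_succ M)
  intro m _
  exact mul_nonneg (h _ (by positivity)) (pow_nonneg (Finset.sum_nonneg fun t _ => mul_nonneg (h _ (hc t)) (hx t)) _)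
end abs

theorem alg1 : ∀ a : ℝ, 0 ≤ a → 0 ≤ algebraMap ℝ ℝ[X] a := by
  intro a ha
  rw [polyLe_iff]; intro i
  rw [Polynomial.algebraMap_apply, Algebra.algebraMap_self, RingHom.id_apply, coeff_C, coeff_zero]
  split_ifs <;> simp [ha]

theorem alg2 : ∀ a : ℝ, 0 ≤ a → 0 ≤ algebraMap ℝ ℝ[X][X] a := by
  intro a ha
  rw [polyLe_iff]; intro i
  rw [Polynomial.algebraMap_apply, coeff_C, coeff_zero]
  split_ifs
  · exact alg1 a ha
  · exact le_rfl

theorem le2 {p q : ℝ[X][X]} : p ≤ q ↔ ∀ i j, (p.coeff i).coeff j ≤ (q.coeff i).coeff j := Iff.rfl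

theorem coeff_mul_le1 {p q : ℝ[X]} (hp : 0 ≤ p) (hq : 0 ≤ q) (i j : ℕ) :
    p.coeff i * q.coeff j ≤ (p * q).coeff (i + j) := by
  rw [coeff_mul]
  exact Finset.single_le_sum (f := fun x : ℕ × ℕ => p.coeff x.1 * q.coeff x.2)
    (fun x _ => mul_nonneg (hp x.1) (hq x.2)) (a := (i, j)) (by simp)

theorem coeff_mul_le2 {p q : ℝ[X][X]} (hp : 0 ≤ p) (hq : 0 ≤ q) (i j k l : ℕ) :
    (p.coeff i).coeff k * (q.coeff j).coeff l ≤ ((p * q).coeff (i + j)).coeff (k + l) := by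
  refine (coeff_mul_le1 (hp i) (hq j) k l).trans ?_
  rw [coeff_mul p q]
  exact (Finset.single_le_sum (f := fun x : ℕ × ℕ => p.coeff x.1 * q.coeff x.2)
    (fun x _ => mul_nonneg (hp x.1) (hq x.2)) (a := (i, j)) (by simp)) (k + l)

theorem coeff_eval1 {p : ℝ[X]} (hp : 0 ≤ p) {x : ℝ} (hx : 0 ≤ x) (i : ℕ) :
    p.coeff i * x^i ≤ p.eval x := by
  rw [eval_eq_sum_range' (n := max (p.natDegree + 1) (i+1)) (by omega)]
  exact Finset.single_le_sum (f := fun i => p.coeff i * x^i)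
    (fun k _ => mul_nonneg (hp k) (pow_nonneg hx k)) (by simp)

theorem coeff_eval2 {p : ℝ[X][X]} (hp : 0 ≤ p) {x y : ℝ} (hx : 0 ≤ x) (hy : 0 ≤ y) (i j : ℕ) :
    (p.coeff i).coeff j * x^i * y^j ≤ (p.eval (C x)).eval y := by
  have h1 : ((p.coeff i) * C x ^ i).eval y ≤ (p.eval (C x)).eval y := by
    rw [eval_eq_sum_range' (p := p) (n := max (p.natDegree + 1) (i+1)) (by omega), eval_finsetSum]
    refine Finset.single_le_sum (f := fun i => eval y (p.coeff i * C x^i)) ?_ (by simp)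
    intro k _
    have := coeff_eval1 (hp k) hy 0
    have h0 := hp k 0
    simp only [coeff_zero] at h0
    simp only [eval_mul, eval_pow, eval_C]
    have h2 : 0 ≤ eval y (p.coeff k) := by
      refine le_trans ?_ this
      simpa using h0
    positivity
  refine le_trans ?_ h1
  simp only [eval_mul, eval_pow, eval_C]
  have := mul_le_mul_of_nonneg_right (coeff_eval1 (hp i) hy j) (pow_nonneg hx i)
  linarith

/-- bivariate polynomials with support in a half plane -/
def halfSub (a b : ℤ) : Submonoid ℝ[X][X] where
  carrier := {p | ∀ i j : ℕ, a * i + b * j < 0 → (p.coeff i).coeff j = 0}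
  one_mem' := by
    intro i j h
    rw [coeff_one]
    split_ifs with hi
    · subst hi
      rw [coeff_one, if_neg]
      rintro rfl
      simp at h
    · simp
  mul_mem' := by
    intro p q hp hq i j h
    rw [coeff_mul, finsetSum_coeff]
    refine Finset.sum_eq_zero fun x hx => ?_
    rw [coeff_mul]
    refine Finset.sum_eq_zero fun z hz => ?_
    rw [HasAntidiagonal.mem_antidiagonal] at hx hz
    by_cases h1 : a * x.1 + b * z.1 < 0
    · rw [hp _ _ h1, zero_mul]
    · have h2 : a * x.2 + b * z.2 < 0 := by
        rw [← hx, ← hz] at h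
        push_cast at h
        linarith
      rw [hq _ _ h2, mul_zero]

/-- mode bound -/
theorem choose_mode (E v : ℕ) (hv : v < E) (p : ℝ) (hp : p = v / E) :
    1 ≤ (E + 1) * ((E.choose v : ℝ) * p^v * (1-p)^(E-v)) := by
  have hE : (0:ℝ) < E := by exact_mod_cast (by omega : 0 < E)
  have hp0 : 0 ≤ p := by rw [hp]; positivity
  have hp1 : 0 < 1 - p := by
    rw [hp, sub_pos, div_lt_one hE]; exact_mod_cast hv
  set T : ℕ → ℝ := fun k => (E.choose k : ℝ) * p^k * (1-p)^(E-k) with hT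
  have step : ∀ k, k < E → (k+1 : ℝ) * (1-p) * T (k+1) = (E - k) * p * T k := by
    intro k hk
    have h1 := Nat.choose_succ_right_eq E k
    have h2 : (E.choose (k+1) : ℝ) * (k+1) = E.choose k * (E - k) := by
      have := congrArg (Nat.cast (R := ℝ)) h1
      push_cast [Nat.cast_sub hk.le] at this
      exact this
    have h3 : E - k = (E - (k+1)) + 1 := by omega
    simp only [hT]
    rw [h3, pow_succ (1-p), pow_succ p k]
    calc _ = (E.choose (k+1) * (k+1:ℝ)) * ((1-p) * (p^k * p) * (1-p)^(E-(k+1))) := by ring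
      _ = _ := by rw [h2]; ring
  have hT0 : ∀ k, 0 ≤ T k := fun k => by simp only [hT]; positivity
  have up : ∀ k, k < v → T k ≤ T (k+1) := by
    intro k hk
    have h1 := step k (by omega)
    have hkv : (k:ℝ) + 1 ≤ v := by exact_mod_cast hk
    have hvE : (v:ℝ) < E := by exact_mod_cast hv
    have h2 : (k+1 : ℝ) * (1-p) ≤ (E - k) * p := by
      have : (v:ℝ) = E * p := by rw [hp]; field_simp
      nlinarith
    have h3 : 0 < (k+1 : ℝ) * (1-p) := by positivity
    by_contra hcon
    push Not at hcon
    have h4 := mul_lt_mul_of_pos_left hcon h3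
    have h5 := mul_le_mul_of_nonneg_right h2 (hT0 k)
    linarith
  have down : ∀ k, v ≤ k → k < E → T (k+1) ≤ T k := by
    intro k hk hkE
    have h1 := step k (by omega)
    have hkv : (v:ℝ) ≤ k := by exact_mod_cast hk
    have hvE : (k:ℝ) < E := by exact_mod_cast hkE
    have h2 : (E - k) * p ≤ (k+1 : ℝ) * (1-p) := by
      have : (v:ℝ) = E * p := by rw [hp]; field_simp
      nlinarith
    have h3 : 0 < (k+1 : ℝ) * (1-p) := by positivity
    have h5 := mul_le_mul_of_nonneg_right h2 (hT0 k)
    rw [← h1] at h5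
    exact le_of_mul_le_mul_left h5 h3
  have hup : ∀ d, d ≤ v → T (v - d) ≤ T v := by
    intro d
    induction d with
    | zero => simp
    | succ d ih =>
      intro hd
      have := up (v - (d+1)) (by omega)
      rw [show v - (d+1) + 1 = v - d by omega] at this
      exact this.trans (ih (by omega))
  have hdown : ∀ d, v + d ≤ E → T (v + d) ≤ T v := by
    intro d
    induction d with
    | zero => simp
    | succ d ih =>
      intro hd
      exact (down (v + d) (by omega) (by omega)).trans (ih (by omega))
  have hall : ∀ k ∈ range (E+1), T k ≤ T v := by
    intro k hk
    rw [Finset.mem_range] at hk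
    rcases le_total k v with h | h
    · have := hup (v - k) (by omega)
      rwa [show v - (v - k) = k by omega] at this
    · have := hdown (k - v) (by omega)
      rwa [show v + (k - v) = k by omega] at this
  have hsum : ∑ k ∈ range (E+1), T k = 1 := by
    have := add_pow p (1-p) E
    rw [add_sub_cancel, one_pow] at this
    rw [this]
    refine Finset.sum_congr rfl fun k _ => ?_
    simp only [hT]; ring
  have := Finset.sum_le_card_nsmul _ _ _ hall
  rw [hsum, card_range, nsmul_eq_mul] at this
  push_cast at this
  exact this

theorem choose_ub (E v : ℕ) (p : ℝ) (hp0 : 0 ≤ p) (hp1 : p ≤ 1) :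
    (E.choose v : ℝ) * p^v * (1-p)^(E-v) ≤ 1 := by
  have h0 : 0 ≤ 1 - p := by linarith
  rcases le_or_gt v E with h | h
  · have := add_pow p (1-p) E
    rw [add_sub_cancel, one_pow] at this
    have h2 := Finset.single_le_sum (s := range (E+1)) (f := fun m => p ^ m * (1 - p) ^ (E - m) * (E.choose m : ℝ)) (fun k _ => by positivity) (a := v) (by simp; omega)
    rw [← this] at h2
    linarith
  · rw [Nat.choose_eq_zero_of_lt h]; simp

/-- abstract Fekete-type convergence -/
theorem fekete (S : Set ℕ) (hS : S.Infinite) (a err : ℕ → ℝ) (U : ℝ) (hU : ∀ n ∈ S, a n ≤ U)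
    (he0 : ∀ n, 0 ≤ err n) (he : Tendsto err atTop (nhds 0))
    (h : ∀ n₁ ∈ S, ∀ ε : ℝ, 0 < ε → ∀ᶠ n in atTop, n ∈ S → a n₁ - err n₁ - ε ≤ a n) :
    ∃ G : ℝ, Tendsto a (atTop ⊓ 𝓟 S) (nhds G) ∧ ∀ n ∈ S, a n - err n ≤ G := by
  set T : Set ℝ := (fun n => a n - err n) '' S
  have hbdd : BddAbove T := ⟨U, by
    rintro _ ⟨n, hn, rfl⟩
    have := hU n hn; have := he0 n
    simp only; linarith⟩
  have hne : T.Nonempty := hS.nonempty.image _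
  have hle : ∀ n ∈ S, a n - err n ≤ sSup T := fun n hn => le_csSup hbdd ⟨n, hn, rfl⟩
  refine ⟨sSup T, ?_, hle⟩
  rw [Metric.tendsto_nhds]
  intro ε hε
  rw [eventually_inf_principal]
  obtain ⟨_, ⟨n₁, hn₁, rfl⟩, hlt⟩ := exists_lt_of_lt_csSup hne (show sSup T - ε/2 < sSup T by linarith)
  have h2 : ∀ᶠ n in atTop, err n < ε := he.eventually (gt_mem_nhds hε)
  filter_upwards [h n₁ hn₁ (ε/2) (by linarith), h2] with n h3 h4 hn
  have := hle n hn
  have := h3 hn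
  rw [Real.dist_eq, abs_lt]
  simp only at hlt
  constructor <;> linarith

end Cor4

namespace Cor4
open Filter Polynomial Finset
open scoped Classical
attribute [local instance] polyPO
attribute [local instance] polyOR

variable (M : DGLDPC)

theorem Acoef (t : Fin M.nc) (u : ℕ) : (M.Apoly t).coeff u = M.A t u := by
  unfold DGLDPC.Apoly
  simp only [finsetSum_coeff, coeff_C_mul, coeff_X_pow, mul_ite, mul_one, mul_zero,
    Finset.sum_ite_eq, Finset.mem_range]
  split_ifs with h
  · rfl
  · rw [M.hAsupp t u (by omega) (Or.inr (by omega))]; simp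

theorem Bcoef (t : Fin M.nv) (u v : ℕ) : ((M.Bpoly t).coeff u).coeff v = M.B t u v := by
  unfold DGLDPC.Bpoly
  simp only [finsetSum_coeff, coeff_C_mul, coeff_X_pow, mul_ite, mul_one, mul_zero,
    Finset.sum_ite_eq, Finset.mem_range]
  split_ifs with h
  · simp only [finsetSum_coeff, coeff_C_mul, coeff_X_pow, mul_ite, mul_one, mul_zero,
    Finset.sum_ite_eq, Finset.mem_range]
    split_ifs with h2
    · rfl
    · rw [M.hBsupp t u v (by omega) (by omega)]; simp
  · rw [M.hBsupp t u v (by omega) (by omega)]; simp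

theorem Anonneg (t : Fin M.nc) : 0 ≤ M.Apoly t := by
  rw [polyLe_iff]; intro i; rw [Acoef]; simp

theorem Bnonneg (t : Fin M.nv) : 0 ≤ M.Bpoly t := by
  rw [le2]; intro i j; rw [Bcoef]; simp

theorem Aprod (e : Fin M.nc → ℕ) : 0 ≤ ∏ t, M.Apoly t ^ e t :=
  Finset.prod_nonneg fun t _ => pow_nonneg (Anonneg M t) _

theorem Bprod (e : Fin M.nv → ℕ) : 0 ≤ ∏ t, M.Bpoly t ^ e t :=
  Finset.prod_nonneg fun t _ => pow_nonneg (Bnonneg M t) _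

theorem Nc_nonneg (n v : ℕ) : 0 ≤ M.NcCount n v := Aprod M _ v
theorem Nv_nonneg (n u v : ℕ) : 0 ≤ M.NvCount n u v := by
  exact (le2.mp (Bprod M (M.vExp n))) u v

theorem Nv_supp1 (n w v : ℕ) (h : M.NvCount n w v ≠ 0) : v ≤ (∑ t, M.q t) * w := by
  by_contra hc
  push Not at hc
  apply h
  have hm : (∏ t, M.Bpoly t ^ M.vExp n t) ∈ halfSub (∑ t, M.q t : ℕ) (-1) := by
    refine prod_mem fun t _ => pow_mem ?_ _
    intro i j hij
    rw [Bcoef]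
    have hq : M.q t ≤ ∑ t, M.q t := Finset.single_le_sum (f := M.q) (fun _ _ => Nat.zero_le _) (Finset.mem_univ t)
    have hij' : (∑ t, M.q t) * i < j := by
      zify; push_cast at hij; linarith
    rw [M.hBsupp t i j (by rintro ⟨rfl, rfl⟩; simp at hij') ?_]
    · simp
    · rintro ⟨h1, _, _, h4⟩
      have := Nat.mul_le_mul hq h1
      omega
  apply hm
  zify at hc
  push_cast
  linarith

theorem Nv_supp2 (n w v : ℕ) (h : M.NvCount n w v ≠ 0) : w ≤ (∑ t, M.kdim t) * v := by
  by_contra hc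
  push Not at hc
  apply h
  have hm : (∏ t, M.Bpoly t ^ M.vExp n t) ∈ halfSub (-1) (∑ t, M.kdim t : ℕ) := by
    refine prod_mem fun t _ => pow_mem ?_ _
    intro i j hij
    rw [Bcoef]
    have hq : M.kdim t ≤ ∑ t, M.kdim t := Finset.single_le_sum (f := M.kdim) (fun _ _ => Nat.zero_le _) (Finset.mem_univ t)
    have hij' : (∑ t, M.kdim t) * j < i := by
      zify; push_cast at hij; linarith
    rw [M.hBsupp t i j (by rintro ⟨rfl, rfl⟩; simp at hij') ?_]
    · simp
    · rintro ⟨h1, h2, h3, h4⟩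
      have h5 := M.h_pd2 t
      have := Nat.mul_le_mul hq (by omega : 1 ≤ j)
      omega
  apply hm
  zify at hc
  push_cast
  linarith

theorem Nv_super (n₁ n₂ : ℕ) (h : ∀ t, M.vExp (n₁ + n₂) t = M.vExp n₁ t + M.vExp n₂ t) (u₁ u₂ v₁ v₂ : ℕ) :
    M.NvCount n₁ u₁ v₁ * M.NvCount n₂ u₂ v₂ ≤ M.NvCount (n₁ + n₂) (u₁ + u₂) (v₁ + v₂) := by
  have e : (∏ t, M.Bpoly t ^ M.vExp (n₁ + n₂) t) = (∏ t, M.Bpoly t ^ M.vExp n₁ t) * (∏ t, M.Bpoly t ^ M.vExp n₂ t) := by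
    rw [← Finset.prod_mul_distrib]
    exact Finset.prod_congr rfl fun t _ => by rw [h, pow_add]
  unfold DGLDPC.NvCount
  rw [e]
  exact coeff_mul_le2 (Bprod M _) (Bprod M _) _ _ _ _

theorem Nc_super (n₁ n₂ : ℕ) (h : ∀ t, M.cExp (n₁ + n₂) t = M.cExp n₁ t + M.cExp n₂ t) (v₁ v₂ : ℕ) :
    M.NcCount n₁ v₁ * M.NcCount n₂ v₂ ≤ M.NcCount (n₁ + n₂) (v₁ + v₂) := by
  have e : (∏ t, M.Apoly t ^ M.cExp (n₁ + n₂) t) = (∏ t, M.Apoly t ^ M.cExp n₁ t) * (∏ t, M.Apoly t ^ M.cExp n₂ t) := by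
    rw [← Finset.prod_mul_distrib]
    exact Finset.prod_congr rfl fun t _ => by rw [h, pow_add]
  unfold DGLDPC.NcCount
  rw [e]
  exact coeff_mul_le1 (Aprod M _) (Aprod M _) _ _

/-- integrality part of admissibility -/
def Intg (α : ℝ) (n : ℕ) : Prop :=
  0 < n ∧ ((M.En n : ℝ) = (n : ℝ) / M.intlam) ∧
  (∀ t, (M.cExp n t : ℝ) = (M.En n : ℝ) * M.ρ t / (M.s t : ℝ)) ∧
  (∀ t, (M.vExp n t : ℝ) = (M.En n : ℝ) * M.lam t / (M.q t : ℝ)) ∧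
  ((⌊α * (n : ℝ)⌋₊ : ℝ) = α * (n : ℝ))

theorem adm_iff (α : ℝ) (n : ℕ) : M.Adm α n ↔ Intg M α n ∧ 0 < M.ENw n ⌊α * (n : ℝ)⌋₊ := by
  unfold DGLDPC.Adm Intg; tauto

theorem intg_add {α : ℝ} {a b : ℕ} (ha : Intg M α a) (hb : Intg M α b) :
    Intg M α (a + b) ∧ M.En (a + b) = M.En a + M.En b ∧
    (∀ t, M.cExp (a + b) t = M.cExp a t + M.cExp b t) ∧
    (∀ t, M.vExp (a + b) t = M.vExp a t + M.vExp b t) ∧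
    ⌊α * ((a + b : ℕ) : ℝ)⌋₊ = ⌊α * (a : ℝ)⌋₊ + ⌊α * (b : ℝ)⌋₊ := by
  obtain ⟨a0, aE, ac, av, aw⟩ := ha
  obtain ⟨b0, bE, bc, bv, bw⟩ := hb
  have hE : M.En (a + b) = M.En a + M.En b := by
    conv_lhs => unfold DGLDPC.En
    have : ((a + b : ℕ) : ℝ) / M.intlam = ((M.En a + M.En b : ℕ) : ℝ) := by
      push_cast; rw [aE, bE]; ring
    rw [this, Nat.floor_natCast]
  have hc : ∀ t, M.cExp (a + b) t = M.cExp a t + M.cExp b t := by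
    intro t
    conv_lhs => unfold DGLDPC.cExp
    have : (M.En (a + b) : ℝ) * M.ρ t / (M.s t : ℝ) = ((M.cExp a t + M.cExp b t : ℕ) : ℝ) := by
      rw [hE]; push_cast; rw [ac, bc]; ring
    rw [this, Nat.floor_natCast]
  have hv : ∀ t, M.vExp (a + b) t = M.vExp a t + M.vExp b t := by
    intro t
    conv_lhs => unfold DGLDPC.vExp
    have : (M.En (a + b) : ℝ) * M.lam t / (M.q t : ℝ) = ((M.vExp a t + M.vExp b t : ℕ) : ℝ) := by
      rw [hE]; push_cast; rw [av, bv]; ring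
    rw [this, Nat.floor_natCast]
  have hw : ⌊α * ((a + b : ℕ) : ℝ)⌋₊ = ⌊α * (a : ℝ)⌋₊ + ⌊α * (b : ℝ)⌋₊ := by
    have : α * ((a + b : ℕ) : ℝ) = ((⌊α * (a : ℝ)⌋₊ + ⌊α * (b : ℝ)⌋₊ : ℕ) : ℝ) := by
      push_cast; rw [aw, bw]; ring
    rw [this, Nat.floor_natCast]
  refine ⟨⟨by omega, ?_, ?_, ?_, ?_⟩, hE, hc, hv, hw⟩
  · rw [hE]; push_cast; rw [aE, bE]; ring
  · intro t; rw [hc, hE]; push_cast; rw [ac, bc]; ring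
  · intro t; rw [hv, hE]; push_cast; rw [av, bv]; ring
  · rw [hw]; push_cast; rw [aw, bw]; ring

theorem intg_mul {α : ℝ} {a : ℕ} (ha : Intg M α a) (j : ℕ) (hj : 0 < j) : Intg M α (j * a) := by
  induction j, hj using Nat.le_induction with
  | base => simpa using ha
  | succ j _ ih => rw [Nat.succ_mul]; exact (intg_add M ih ha).1

theorem super_iter {α : ℝ} {n₁ n₂ : ℕ} (h₁ : Intg M α n₁) (h₂ : Intg M α n₂) (v₁ v₂ k : ℕ) :
    Intg M α (n₂ + k * n₁) ∧ M.En (n₂ + k * n₁) = M.En n₂ + k * M.En n₁ ∧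
    M.NvCount n₁ ⌊α * (n₁ : ℝ)⌋₊ v₁ ^ k * M.NvCount n₂ ⌊α * (n₂ : ℝ)⌋₊ v₂ ≤
      M.NvCount (n₂ + k * n₁) ⌊α * ((n₂ + k * n₁ : ℕ) : ℝ)⌋₊ (v₂ + k * v₁) ∧
    M.NcCount n₁ v₁ ^ k * M.NcCount n₂ v₂ ≤ M.NcCount (n₂ + k * n₁) (v₂ + k * v₁) := by
  induction k with
  | zero => simp [h₂]
  | succ k ih =>
    obtain ⟨i1, i2, i3, i4⟩ := ih
    obtain ⟨j1, j2, j3, j4, j5⟩ := intg_add M i1 h₁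
    have e1 : n₂ + (k+1) * n₁ = n₂ + k * n₁ + n₁ := by ring
    have e2 : v₂ + (k+1) * v₁ = v₂ + k * v₁ + v₁ := by ring
    rw [e1, e2]
    refine ⟨j1, by rw [j2, i2]; ring, ?_, ?_⟩
    · rw [j5]
      refine le_trans ?_ (Nv_super M _ _ j4 _ _ _ _)
      rw [pow_succ]
      calc _ = (M.NvCount n₁ ⌊α * (n₁ : ℝ)⌋₊ v₁ ^ k * M.NvCount n₂ ⌊α * (n₂ : ℝ)⌋₊ v₂) * M.NvCount n₁ ⌊α * (n₁ : ℝ)⌋₊ v₁ := by ring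
        _ ≤ _ := mul_le_mul_of_nonneg_right i3 (Nv_nonneg M _ _ _)
    · refine le_trans ?_ (Nc_super M _ _ j3 _ _)
      rw [pow_succ]
      calc _ = (M.NcCount n₁ v₁ ^ k * M.NcCount n₂ v₂) * M.NcCount n₁ v₁ := by ring
        _ ≤ _ := mul_le_mul_of_nonneg_right i4 (Nc_nonneg M _ _)

theorem term_nonneg (n w v : ℕ) : 0 ≤ M.NvCount n w v * M.NcCount n v / ((M.En n).choose v : ℝ) :=
  div_nonneg (mul_nonneg (Nv_nonneg M _ _ _) (Nc_nonneg M _ _)) (Nat.cast_nonneg _)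

theorem ENw_ge (n w v : ℕ) (hv : v ≤ M.En n) :
    M.NvCount n w v * M.NcCount n v / ((M.En n).choose v : ℝ) ≤ M.ENw n w := by
  unfold DGLDPC.ENw
  exact Finset.single_le_sum (f := fun v => M.NvCount n w v * M.NcCount n v / ((M.En n).choose v : ℝ))
    (fun k _ => term_nonneg M n w k) (by simpa using Nat.lt_succ_of_le hv)

theorem ENw_max (n w : ℕ) : ∃ v ≤ M.En n, M.ENw n w ≤ (M.En n + 1) *
    (M.NvCount n w v * M.NcCount n v / ((M.En n).choose v : ℝ)) := by
  by_contra hc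
  push Not at hc
  have hE : (0:ℝ) < M.En n + 1 := by positivity
  have : M.ENw n w < ∑ v ∈ range (M.En n + 1), M.ENw n w / (M.En n + 1) := by
    conv_lhs => unfold DGLDPC.ENw
    refine Finset.sum_lt_sum_of_nonempty (by simp) fun v hv => ?_
    rw [Finset.mem_range] at hv
    rw [lt_div_iff₀ hE, mul_comm]
    exact hc v (by omega)
  rw [Finset.sum_const, card_range, nsmul_eq_mul] at this
  push_cast at this
  rw [mul_div_cancel₀ _ hE.ne'] at this
  exact lt_irrefl _ this

end Cor4

namespace Cor4
open Filter Polynomial Finset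
open scoped Classical
variable (M : DGLDPC)

theorem intlam_pos : 0 < M.intlam := by
  unfold DGLDPC.intlam
  have : Nonempty (Fin M.nv) := ⟨⟨0, M.hnv⟩⟩
  exact Finset.sum_pos (fun t _ => div_pos (M.hlampos t) (by have := M.h_q1 t; positivity)) Finset.univ_nonempty

/-- the error term -/
noncomputable def errf (n : ℕ) : ℝ := 2 * Real.log (M.En n + 1) / n

theorem errf_nonneg (n : ℕ) : 0 ≤ errf M n := by
  unfold errf
  have := Real.log_nonneg (show (1:ℝ) ≤ M.En n + 1 by simp)
  positivity

theorem log_lin (c : ℝ) (hc : 0 ≤ c) : Tendsto (fun n : ℕ => Real.log (c * n + 1) / n) atTop (nhds 0) := by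
  have h1 : Tendsto (fun n : ℕ => Real.log ((c+1) * n) / n) atTop (nhds 0) := by
    have h2 : Tendsto (fun x : ℝ => Real.log ((c+1) * x) / x) atTop (nhds 0) := by
      have h3 : Tendsto (fun x : ℝ => Real.log x / x) atTop (nhds 0) :=
        Real.isLittleO_log_id_atTop.tendsto_div_nhds_zero
      have h4 : Tendsto (fun x : ℝ => Real.log (c+1) / x) atTop (nhds 0) :=
        tendsto_const_nhds.div_atTop tendsto_id
      have h5 := h4.add h3
      rw [add_zero] at h5
      refine h5.congr' ?_
      filter_upwards [eventually_gt_atTop 0] with x hx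
      rw [Real.log_mul (by positivity) hx.ne']; ring
    exact h2.comp tendsto_natCast_atTop_atTop
  refine squeeze_zero' (Eventually.of_forall fun n => ?_) ?_ h1
  · have := Real.log_nonneg (show (1:ℝ) ≤ c * n + 1 by
      have : 0 ≤ c * n := by positivity
      linarith)
    positivity
  · filter_upwards [eventually_ge_atTop 1] with n hn
    have hn' : (1:ℝ) ≤ n := by exact_mod_cast hn
    have : 0 ≤ c * n := by positivity
    gcongr
    linarith

theorem errf_tendsto : Tendsto (errf M) atTop (nhds 0) := by
  have hl := intlam_pos M
  have h1 := (log_lin (1 / M.intlam) (by positivity)).const_mul 2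
  rw [mul_zero] at h1
  refine squeeze_zero (errf_nonneg M) (fun n => ?_) h1
  unfold errf
  rw [mul_div_assoc]
  have : (M.En n : ℝ) ≤ 1 / M.intlam * n := by
    unfold DGLDPC.En
    refine (Nat.floor_le (by positivity)).trans_eq (by ring)
  gcongr

theorem fek_step (α : ℝ) (hα : 0 < α) (hα1 : α * M.intlam * (∑ t, M.q t : ℕ) < 1)
    (n₁ : ℕ) (h₁ : M.Adm α n₁) (ε : ℝ) (hε : 0 < ε) :
    ∀ᶠ n in atTop, n ∈ {n | M.Adm α n} → M.grSeq α n₁ - errf M n₁ - ε ≤ M.grSeq α n := by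
  have hl := intlam_pos M
  obtain ⟨hi, hpos⟩ := (adm_iff M α n₁).mp h₁
  obtain ⟨hn0, hE, _, _, hw⟩ := id hi
  set w₁ := ⌊α * (n₁ : ℝ)⌋₊
  have hn0' : (0:ℝ) < n₁ := by exact_mod_cast hn0
  obtain ⟨v₁, hv₁, hmax⟩ := ENw_max M n₁ w₁
  set E₁ := M.En n₁
  have hE1 : (0:ℝ) < E₁ := by rw [hE]; positivity
  have hE2 : (0:ℝ) < E₁ + 1 := by linarith
  have hT : 0 < M.NvCount n₁ w₁ v₁ * M.NcCount n₁ v₁ / (E₁.choose v₁ : ℝ) := by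
    by_contra hc
    push Not at hc
    have := mul_nonpos_of_nonneg_of_nonpos hE2.le hc
    linarith
  have hNv : M.NvCount n₁ w₁ v₁ ≠ 0 := by intro h; rw [h] at hT; simp at hT
  have hNc : M.NcCount n₁ v₁ ≠ 0 := by intro h; rw [h] at hT; simp at hT
  have hNv' := lt_of_le_of_ne (Nv_nonneg M _ _ _) hNv.symm
  have hNc' := lt_of_le_of_ne (Nc_nonneg M _ _) hNc.symm
  have hs1 := Nv_supp1 M _ _ _ hNv
  have hs2 := Nv_supp2 M _ _ _ hNv
  have hw1 : (0:ℝ) < w₁ := by rw [hw]; positivity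
  have hv0 : 0 < v₁ := by
    rcases Nat.eq_zero_or_pos v₁ with h | h
    · rw [h, mul_zero] at hs2
      have : w₁ = 0 := by omega
      rw [this] at hw1; simp at hw1
    · exact h
  have hvE : v₁ < E₁ := by
    have h1 : (v₁:ℝ) ≤ (∑ t, M.q t : ℕ) * w₁ := by exact_mod_cast hs1
    have h2 : (w₁:ℝ) = α * M.intlam * E₁ := by rw [hw, hE]; field_simp
    have : (v₁:ℝ) < E₁ := by
      rw [h2] at h1
      nlinarith
    exact_mod_cast this
  set p : ℝ := v₁ / E₁ with hp
  have hp0 : 0 < p := by rw [hp]; have : (0:ℝ) < v₁ := by exact_mod_cast hv0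
                         positivity
  have hp1 : 0 < 1 - p := by
    rw [hp, sub_pos, div_lt_one hE1]; exact_mod_cast hvE
  have hmode := choose_mode E₁ v₁ hvE p hp
  set D₁ := M.NvCount n₁ w₁ v₁ * M.NcCount n₁ v₁ * (p^v₁ * (1-p)^(E₁-v₁)) with hD₁
  have hD1pos : 0 < D₁ := by positivity
  have hD1 : M.ENw n₁ w₁ ≤ (E₁+1)^2 * D₁ := by
    refine hmax.trans ?_
    have hc : (0:ℝ) < E₁.choose v₁ := by exact_mod_cast Nat.choose_pos hv₁
    calc (E₁+1) * (M.NvCount n₁ w₁ v₁ * M.NcCount n₁ v₁ / (E₁.choose v₁ : ℝ)) =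
      (E₁+1) * (M.NvCount n₁ w₁ v₁ * M.NcCount n₁ v₁ / (E₁.choose v₁ : ℝ)) * 1 := by ring
      _ ≤ (E₁+1) * (M.NvCount n₁ w₁ v₁ * M.NcCount n₁ v₁ / (E₁.choose v₁ : ℝ)) * ((E₁ + 1) * ((E₁.choose v₁ : ℝ) * p^v₁ * (1-p)^(E₁-v₁))) := by gcongr
      _ = _ := by rw [hD₁]; field_simp
  have hL : M.grSeq α n₁ - errf M n₁ ≤ Real.log D₁ / n₁ := by
    have h1 := Real.log_le_log hpos hD1
    rw [Real.log_mul (by positivity) (by positivity), Real.log_pow] at h1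
    push_cast at h1
    change (1 / (n₁:ℝ)) * Real.log (M.ENw n₁ w₁) - 2 * Real.log ((E₁:ℝ) + 1) / n₁ ≤ _
    rw [le_div_iff₀ hn0']
    have e0 : ((1 / (n₁:ℝ)) * Real.log (M.ENw n₁ w₁) - 2 * Real.log ((E₁:ℝ) + 1) / n₁) * n₁ =
      Real.log (M.ENw n₁ w₁) - 2 * Real.log ((E₁:ℝ) + 1) := by
      generalize Real.log (M.ENw n₁ w₁) = A
      field_simp
    linarith
  have hcls : ∀ c ∈ range n₁, ∀ᶠ n in atTop, n % n₁ = c → M.Adm α n →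
      Real.log D₁ / n₁ - ε ≤ M.grSeq α n := by
    intro c _
    by_cases hex : ∃ n₂, n₂ % n₁ = c ∧ M.Adm α n₂
    swap
    · exact Eventually.of_forall fun n h1 h2 => absurd ⟨n, h1, h2⟩ hex
    obtain ⟨n₂, hc2, h₂⟩ := hex
    obtain ⟨hi2, hpos2⟩ := (adm_iff M α n₂).mp h₂
    obtain ⟨v₂, hv₂, hmax2⟩ := ENw_max M n₂ ⌊α * (n₂ : ℝ)⌋₊
    have hT2 : 0 < M.NvCount n₂ ⌊α * (n₂ : ℝ)⌋₊ v₂ * M.NcCount n₂ v₂ / ((M.En n₂).choose v₂ : ℝ) := by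
      by_contra hc
      push Not at hc
      have := mul_nonpos_of_nonneg_of_nonpos (show (0:ℝ) ≤ M.En n₂ + 1 by positivity) hc
      linarith
    have hNv2 : M.NvCount n₂ ⌊α * (n₂ : ℝ)⌋₊ v₂ ≠ 0 := by intro h; rw [h] at hT2; simp at hT2
    have hNc2 : M.NcCount n₂ v₂ ≠ 0 := by intro h; rw [h] at hT2; simp at hT2
    have hNv2' := lt_of_le_of_ne (Nv_nonneg M _ _ _) hNv2.symm
    have hNc2' := lt_of_le_of_ne (Nc_nonneg M _ _) hNc2.symm
    set D₂ := M.NvCount n₂ ⌊α * (n₂ : ℝ)⌋₊ v₂ * M.NcCount n₂ v₂ * (p^v₂ * (1-p)^(M.En n₂-v₂)) with hD₂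
    have hD2pos : 0 < D₂ := by positivity
    have hlim : Tendsto (fun n : ℕ => (Real.log D₂ - n₂ * Real.log D₁ / n₁) / (n:ℝ)) atTop (nhds 0) :=
      tendsto_const_nhds.div_atTop tendsto_natCast_atTop_atTop
    have hev := hlim.eventually (lt_mem_nhds (show -ε < 0 by linarith))
    filter_upwards [hev, eventually_ge_atTop n₂, eventually_gt_atTop 0] with n h1 h2 h3 h4 h5
    obtain ⟨k, rfl⟩ : ∃ k, n = n₂ + k * n₁ := by
      have : n₂ ≡ n [MOD n₁] := by unfold Nat.ModEq; rw [hc2, h4]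
      obtain ⟨k, hk⟩ := (Nat.modEq_iff_dvd' h2).mp this
      exact ⟨k, by rw [mul_comm]; omega⟩
    obtain ⟨s1, s2, s3, s4⟩ := super_iter M hi hi2 v₁ v₂ k
    have hvle : v₂ + k * v₁ ≤ M.En (n₂ + k * n₁) := by
      rw [s2]; exact Nat.add_le_add hv₂ (Nat.mul_le_mul_left _ hv₁)
    have hge := ENw_ge M (n₂ + k * n₁) ⌊α * ((n₂ + k * n₁ : ℕ) : ℝ)⌋₊ _ hvle
    have hcu := choose_ub (M.En (n₂ + k * n₁)) (v₂ + k * v₁) p hp0.le (by linarith)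
    have hcp : (0:ℝ) < (M.En (n₂ + k * n₁)).choose (v₂ + k * v₁) := by exact_mod_cast Nat.choose_pos hvle
    have hmain : D₁^k * D₂ ≤ M.ENw (n₂ + k * n₁) ⌊α * ((n₂ + k * n₁ : ℕ) : ℝ)⌋₊ := by
      refine le_trans ?_ hge
      rw [le_div_iff₀ hcp]
      have e1 : M.En (n₂ + k * n₁) - (v₂ + k * v₁) = (M.En n₂ - v₂) + (E₁ - v₁) * k := by
        rw [s2, Nat.sub_mul, mul_comm E₁, mul_comm v₁]
        have h7 := Nat.mul_le_mul_left k hv₁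
        change M.En n₂ + k * E₁ - (v₂ + k * v₁) = _
        generalize k * E₁ = x at *
        generalize k * v₁ = z at *
        omega
      rw [e1] at hcu
      calc D₁^k * D₂ * ((M.En (n₂ + k * n₁)).choose (v₂ + k * v₁) : ℝ) =
        ((M.NvCount n₁ w₁ v₁ ^ k * M.NvCount n₂ ⌊α * (n₂ : ℝ)⌋₊ v₂) * (M.NcCount n₁ v₁ ^ k * M.NcCount n₂ v₂)) *
          (((M.En (n₂ + k * n₁)).choose (v₂ + k * v₁) : ℝ) * p^(v₂ + k * v₁) * (1-p)^((M.En n₂ - v₂) + (E₁ - v₁) * k)) := by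
            rw [hD₁, hD₂, pow_add, pow_add, mul_comm k v₁, pow_mul, pow_mul, mul_pow, mul_pow, mul_pow]; ring
        _ ≤ ((M.NvCount n₁ w₁ v₁ ^ k * M.NvCount n₂ ⌊α * (n₂ : ℝ)⌋₊ v₂) * (M.NcCount n₁ v₁ ^ k * M.NcCount n₂ v₂)) * 1 := by gcongr
        _ ≤ _ := by
          rw [mul_one]
          exact mul_le_mul s3 s4 (by positivity) (Nv_nonneg M _ _ _)
    have hlog := Real.log_le_log (by positivity) hmain
    rw [Real.log_mul (by positivity) (by positivity), Real.log_pow] at hlog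
    have h3' : (0:ℝ) < ((n₂ + k * n₁ : ℕ) : ℝ) := by exact_mod_cast h3
    unfold DGLDPC.grSeq
    have e : Real.log D₁ / n₁ + (Real.log D₂ - n₂ * Real.log D₁ / n₁) / ((n₂ + k * n₁ : ℕ) : ℝ) =
        (1 / ((n₂ + k * n₁ : ℕ) : ℝ)) * (k * Real.log D₁ + Real.log D₂) := by
      field_simp
      push_cast
      ring
    have h6 : (1 / ((n₂ + k * n₁ : ℕ) : ℝ)) * (k * Real.log D₁ + Real.log D₂) ≤
      (1 / ((n₂ + k * n₁ : ℕ) : ℝ)) * Real.log (M.ENw (n₂ + k * n₁) ⌊α * ((n₂ + k * n₁ : ℕ) : ℝ)⌋₊) := by gcongr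
    linarith
  have hall := (Filter.eventually_all_finset (range n₁)).mpr hcls
  filter_upwards [hall] with n hn hadm
  have := hn (n % n₁) (Finset.mem_range.mpr (Nat.mod_lt _ hn0)) rfl hadm
  linarith

end Cor4

namespace Cor4
open Filter Polynomial Finset
open scoped Classical
attribute [local instance] polyPO
attribute [local instance] polyOR
variable (M : DGLDPC)

theorem spos (t : Fin M.nc) : (0:ℝ) < M.s t := by
  have := M.h_hs t
  exact_mod_cast (by omega : 0 < M.s t)

theorem qpos (t : Fin M.nv) : (0:ℝ) < M.q t := by
  have := M.h_q1 t
  exact_mod_cast (by omega : 0 < M.q t)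

theorem Cparam_eq (hr : M.r = 2) : M.Cparam = 2 * ∑ t, M.ρ t / M.s t * M.A t 2 := by
  unfold DGLDPC.Cparam
  rw [hr, Finset.sum_filter]
  push_cast
  congr 1
  refine Finset.sum_congr rfl fun t _ => ?_
  split_ifs with h
  · ring
  · have := M.h_rd2 t
    rw [M.hAsupp t 2 (by omega) (Or.inl (by omega))]; simp

theorem Cparam_pos (hr : M.r = 2) : 0 < M.Cparam := by
  rw [Cparam_eq M hr]
  have : Nonempty (Fin M.nc) := ⟨⟨0, M.hnc⟩⟩
  have hm : M.r ∈ Set.range M.rd := Nat.sInf_mem (Set.range_nonempty _)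
  obtain ⟨t, ht⟩ := hm
  have h1 := M.hAr t
  rw [ht, hr] at h1
  have h2 : 0 < ∑ t, M.ρ t / M.s t * M.A t 2 := by
    apply Finset.sum_pos'
    · intro t _
      have := M.hρpos t; have := spos M t
      positivity
    · refine ⟨t, Finset.mem_univ t, ?_⟩
      have := M.hρpos t; have := spos M t
      positivity
  linarith

/-- the polynomial P -/
noncomputable def PP : ℝ[X] := ∑ t, Polynomial.C (2 * (M.lam t / M.q t)) *
  ∑ i ∈ range (M.kdim t + 1), Polynomial.C (M.B t i 2 : ℝ) * X^i

theorem PP_eval (hp : M.p = 2) (x : ℝ) : (PP M).eval x = M.Pfun x := by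
  unfold PP DGLDPC.Pfun
  rw [hp, Finset.sum_filter, Finset.mul_sum, eval_finsetSum]
  refine Finset.sum_congr rfl fun t _ => ?_
  simp only [eval_mul, eval_C, eval_finsetSum, eval_pow, eval_X]
  split_ifs with h
  · ring
  · have := M.h_pd2 t
    have : ∀ i, M.B t i 2 = 0 := fun i => M.hBsupp t i 2 (by omega) (by omega)
    simp [this]

theorem PP_coeff (i : ℕ) : (PP M).coeff i = ∑ t, 2 * (M.lam t / M.q t) * M.B t i 2 := by
  unfold PP
  rw [finsetSum_coeff]
  refine Finset.sum_congr rfl fun t _ => ?_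
  simp only [coeff_C_mul, finsetSum_coeff, coeff_X_pow, mul_ite, mul_one, mul_zero,
    Finset.sum_ite_eq, Finset.mem_range]
  split_ifs with h
  · rfl
  · rw [M.hBsupp t i 2 (by omega) (by omega)]; simp

theorem PP_nonneg : 0 ≤ PP M := by
  rw [polyLe_iff]; intro i; rw [PP_coeff, coeff_zero]
  refine Finset.sum_nonneg fun t _ => ?_
  have := M.hlampos t; have := qpos M t
  positivity

theorem PP_zero : (PP M).coeff 0 = 0 := by
  rw [PP_coeff]
  refine Finset.sum_eq_zero fun t _ => ?_
  rw [M.hBsupp t 0 2 (by omega) (by omega)]; simp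

theorem PP_pos (hp : M.p = 2) : ∃ i, 0 < i ∧ 0 < (PP M).coeff i := by
  have : Nonempty (Fin M.nv) := ⟨⟨0, M.hnv⟩⟩
  have hm : M.p ∈ Set.range M.pd := Nat.sInf_mem (Set.range_nonempty _)
  obtain ⟨t, ht⟩ := hm
  obtain ⟨u, hu⟩ := M.hBp t
  rw [ht, hp] at hu
  refine ⟨u, ?_, ?_⟩
  · rcases Nat.eq_zero_or_pos u with rfl | h
    · rw [M.hBsupp t 0 2 (by omega) (by omega)] at hu; omega
    · exact h
  · rw [PP_coeff]
    apply Finset.sum_pos'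
    · intro t _
      have := M.hlampos t; have := qpos M t
      positivity
    · refine ⟨t, Finset.mem_univ t, ?_⟩
      have := M.hlampos t; have := qpos M t
      positivity

theorem exists_y (hr : M.r = 2) (hp : M.p = 2) : ∃ y : ℝ, 0 < y ∧ M.Pfun y = 1 / M.Cparam ∧
    ∀ y' : ℝ, 0 ≤ y' → M.Pfun y' = 1 / M.Cparam → y' = y := by
  have hC := Cparam_pos M hr
  obtain ⟨i, hi, hci⟩ := PP_pos M hp
  have hmono : ∀ a b : ℝ, 0 ≤ a → a < b → M.Pfun a < M.Pfun b := by
    intro a b ha hab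
    rw [← PP_eval M hp, ← PP_eval M hp, eval_eq_sum_range, eval_eq_sum_range]
    apply Finset.sum_lt_sum
    · intro k _
      have := (PP_nonneg M) k
      simp only [coeff_zero] at this
      gcongr
    · refine ⟨i, ?_, ?_⟩
      · rw [Finset.mem_range]
        exact Nat.lt_succ_of_le (le_natDegree_of_ne_zero hci.ne')
      · have := pow_lt_pow_left₀ hab ha hi.ne'
        gcongr
  have hcont : Continuous M.Pfun := by
    have : M.Pfun = fun x => (PP M).eval x := funext fun x => (PP_eval M hp x).symm
    rw [this]; exact (PP M).continuous
  have h0 : M.Pfun 0 = 0 := by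
    rw [← PP_eval M hp, ← coeff_zero_eq_eval_zero, PP_zero]
  set b : ℝ := max 1 (1 / M.Cparam / (PP M).coeff i) with hb
  have hb1 : 1 ≤ b := le_max_left _ _
  have hb2 : 1 / M.Cparam ≤ M.Pfun b := by
    rw [← PP_eval M hp]
    refine le_trans ?_ (coeff_eval1 (PP_nonneg M) (by linarith) i)
    have h1 : 1 / M.Cparam / (PP M).coeff i ≤ b := le_max_right _ _
    rw [div_le_iff₀ hci] at h1
    have h2 : b ≤ b^i := le_self_pow₀ hb1 hi.ne'
    nlinarith
  have hCinv : 0 < 1 / M.Cparam := by positivity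
  obtain ⟨y, ⟨hy0, _⟩, hy⟩ := intermediate_value_Icc (show (0:ℝ) ≤ b by linarith) hcont.continuousOn
    (show 1 / M.Cparam ∈ Set.Icc (M.Pfun 0) (M.Pfun b) by rw [h0]; exact ⟨hCinv.le, hb2⟩)
  refine ⟨y, ?_, hy, ?_⟩
  · rcases hy0.lt_or_eq with h | h
    · exact h
    · rw [← h, h0] at hy; linarith
  · intro y' hy' hPy'
    rcases lt_trichotomy y' y with h | h | h
    · have := hmono _ _ hy' h; linarith
    · exact h
    · have := hmono _ _ hy0 h; linarith

theorem xi_bdd : BddBelow ({2} ∪ {x : ℝ | ∃ i : ℕ, M.r < i ∧ (∃ t, 0 < M.A t i) ∧ x = (i : ℝ) / 2}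
    ∪ {x : ℝ | ∃ j : ℕ, M.p < j ∧ (∃ t i, 0 < M.B t i j) ∧ x = (j : ℝ) / 2}) := by
  refine ⟨0, ?_⟩
  rintro x ((rfl | ⟨i, _, _, rfl⟩) | ⟨i, _, _, rfl⟩)
  · norm_num
  · positivity
  · positivity

theorem xi_le2 : M.xiexp2 ≤ 2 := csInf_le (xi_bdd M) (Or.inl (Or.inl rfl))

theorem xi_nonneg : 0 ≤ M.xiexp2 := by
  refine le_csInf ⟨2, Or.inl (Or.inl rfl)⟩ ?_
  rintro x ((rfl | ⟨i, _, _, rfl⟩) | ⟨i, _, _, rfl⟩)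
  · norm_num
  · positivity
  · positivity

theorem xi_leA (hr : M.r = 2) (t) (i : ℕ) (hi : 3 ≤ i) (h : 0 < M.A t i) : M.xiexp2 ≤ i / 2 :=
  csInf_le (xi_bdd M) (Or.inl (Or.inr ⟨i, by omega, ⟨t, h⟩, rfl⟩))

theorem xi_leB (hp : M.p = 2) (t) (i j : ℕ) (hj : 3 ≤ j) (h : 0 < M.B t i j) : M.xiexp2 ≤ j / 2 :=
  csInf_le (xi_bdd M) (Or.inr ⟨j, by omega, ⟨t, i, h⟩, rfl⟩)

theorem pow_le_xi {u ξ : ℝ} (hu : 0 < u) (hu1 : u ≤ 1) (i : ℕ) (h : ξ ≤ i / 2) : u^i ≤ (u^2)^ξ := by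
  have h1 : u^i = (u^2)^((i:ℝ)/2) := by
    rw [← Real.rpow_natCast u 2, ← Real.rpow_mul hu.le, ← Real.rpow_natCast u i]
    congr 1
    push_cast; ring
  rw [h1]
  exact Real.rpow_le_rpow_of_exponent_ge (by positivity) (pow_le_one₀ hu.le hu1) h

theorem A_eval (hr : M.r = 2) (t) {u : ℝ} (hu : 0 < u) (hu1 : u ≤ 1) :
    (M.Apoly t).eval u ≤ Real.exp (M.A t 2 * u^2 + (∑ i ∈ range (M.s t + 1), (M.A t i : ℝ)) * (u^2)^M.xiexp2) := by
  have hx : 0 ≤ (u^2)^M.xiexp2 := by positivity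
  have h1 : (M.Apoly t).eval u ≤ ∑ i ∈ range (M.s t + 1), ((if i = 0 then 1 else 0) +
      (if i = 2 then M.A t 2 * u^2 else 0) + (M.A t i : ℝ) * (u^2)^M.xiexp2) := by
    unfold DGLDPC.Apoly
    rw [eval_finsetSum]
    refine Finset.sum_le_sum fun i _ => ?_
    simp only [eval_mul, eval_C, eval_pow, eval_X]
    rcases lt_or_ge i 3 with h | h
    · have := M.h_rd2 t
      interval_cases i
      · simp [M.hA0 t]; positivity
      · rw [M.hAsupp t 1 (by omega) (Or.inl (by omega))]; simp
      · simp; positivity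
    · rw [if_neg (by omega), if_neg (by omega), zero_add, zero_add]
      rcases Nat.eq_zero_or_pos (M.A t i) with h0 | h0
      · simp [h0]
      · have := pow_le_xi hu hu1 i (xi_leA M hr t i h h0)
        gcongr
  refine h1.trans ?_
  rw [Finset.sum_add_distrib, Finset.sum_add_distrib, Finset.sum_ite_eq', Finset.sum_ite_eq', ← Finset.sum_mul,
    if_pos (by simp), if_pos (by have := M.h_rd2 t; have := M.h_rds t; simp; omega)]
  have := Real.add_one_le_exp (M.A t 2 * u^2 + (∑ i ∈ range (M.s t + 1), (M.A t i : ℝ)) * (u^2)^M.xiexp2)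
  linarith

theorem B_eval (hp : M.p = 2) (t) {y z : ℝ} (hy : 0 < y) (hz : 0 < z) (hz1 : z ≤ 1) :
    ((M.Bpoly t).eval (C y)).eval z ≤ Real.exp ((∑ i ∈ range (M.kdim t + 1), (M.B t i 2 : ℝ) * y^i) * z^2 +
      (∑ i ∈ range (M.kdim t + 1), ∑ j ∈ range (M.q t + 1), (M.B t i j : ℝ) * y^i) * (z^2)^M.xiexp2) := by
  have hx : 0 ≤ (z^2)^M.xiexp2 := by positivity
  have h1 : ((M.Bpoly t).eval (C y)).eval z ≤ ∑ i ∈ range (M.kdim t + 1), ∑ j ∈ range (M.q t + 1),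
      ((if i = 0 then (if j = 0 then 1 else 0) else 0) +
      (if j = 2 then (M.B t i 2 : ℝ) * y^i * z^2 else 0) + (M.B t i j : ℝ) * y^i * (z^2)^M.xiexp2) := by
    unfold DGLDPC.Bpoly
    rw [eval_finsetSum, eval_finsetSum]
    refine Finset.sum_le_sum fun i _ => ?_
    simp only [eval_mul, eval_C, eval_pow, eval_X, eval_finsetSum]
    rw [Finset.sum_mul]
    refine Finset.sum_le_sum fun j _ => ?_
    have hi : (0:ℝ) ≤ (if i = 0 then (if j = 0 then 1 else 0) else 0) := by split_ifs <;> norm_num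
    rcases lt_or_ge j 3 with h | h
    · have := M.h_pd2 t
      interval_cases j
      · rcases Nat.eq_zero_or_pos i with rfl | h0
        · simp [M.hB00 t]; positivity
        · rw [M.hBsupp t i 0 (by omega) (by omega)]; simp; positivity
      · rw [M.hBsupp t i 1 (by omega) (by omega)]; simp
      · simp
        nlinarith [show 0 ≤ (M.B t i 2 : ℝ) * y^i * (z^2)^M.xiexp2 by positivity]
    · rw [if_neg (show ¬ j = 2 by omega), add_zero]
      rcases Nat.eq_zero_or_pos (M.B t i j) with h0 | h0
      · simp [h0]; simpa using hi
      · have := pow_le_xi hz hz1 j (xi_leB M hp t i j h h0)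
        have h3 : (M.B t i j : ℝ) * z^j * y^i ≤ (M.B t i j : ℝ) * (z^2)^M.xiexp2 * y^i := by gcongr
        linarith
  refine h1.trans ?_
  have hq : 2 < M.q t + 1 := by have := M.h_pd2 t; have := M.h_pdq t; omega
  have e : ∑ i ∈ range (M.kdim t + 1), ∑ j ∈ range (M.q t + 1),
      ((if i = 0 then (if j = 0 then (1:ℝ) else 0) else 0) +
      (if j = 2 then (M.B t i 2 : ℝ) * y^i * z^2 else 0) + (M.B t i j : ℝ) * y^i * (z^2)^M.xiexp2) =
      1 + (∑ i ∈ range (M.kdim t + 1), (M.B t i 2 : ℝ) * y^i) * z^2 +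
      (∑ i ∈ range (M.kdim t + 1), ∑ j ∈ range (M.q t + 1), (M.B t i j : ℝ) * y^i) * (z^2)^M.xiexp2 := by
    simp only [Finset.sum_add_distrib, Finset.sum_ite_eq', Finset.mem_range, if_pos hq, Finset.sum_mul]
    congr 2
    have : ∀ i, ∑ j ∈ range (M.q t + 1), (if i = 0 then (if j = 0 then (1:ℝ) else 0) else 0) = if i = 0 then 1 else 0 := by
      intro i
      split_ifs with h
      · rw [Finset.sum_ite_eq', if_pos (by simp)]
      · simp
    simp only [this]
    rw [Finset.sum_ite_eq', if_pos (by simp)]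
  rw [e]
  have := Real.add_one_le_exp ((∑ i ∈ range (M.kdim t + 1), (M.B t i 2 : ℝ) * y^i) * z^2 +
      (∑ i ∈ range (M.kdim t + 1), ∑ j ∈ range (M.q t + 1), (M.B t i j : ℝ) * y^i) * (z^2)^M.xiexp2)
  linarith

/-- CN constant -/
noncomputable def K1 : ℝ := ∑ t, M.ρ t / M.s t * ∑ i ∈ range (M.s t + 1), (M.A t i : ℝ)
/-- VN constant -/
noncomputable def K2 (y : ℝ) : ℝ := ∑ t, M.lam t / M.q t *
  ∑ i ∈ range (M.kdim t + 1), ∑ j ∈ range (M.q t + 1), (M.B t i j : ℝ) * y^i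

theorem K1_nonneg : 0 ≤ K1 M := Finset.sum_nonneg fun t _ => by
  have := M.hρpos t; have := spos M t
  positivity
theorem K2_nonneg {y : ℝ} (hy : 0 < y) : 0 ≤ K2 M y := Finset.sum_nonneg fun t _ => by
  have := M.hlampos t; have := qpos M t
  positivity

theorem eval_nonneg {p : ℝ[X]} (hp : 0 ≤ p) {x : ℝ} (hx : 0 ≤ x) : 0 ≤ p.eval x := by
  refine le_trans ?_ (coeff_eval1 hp hx 0)
  have := hp 0
  simpa using this

theorem Nc_ub (hr : M.r = 2) {α : ℝ} {n : ℕ} (hi : Intg M α n) (v : ℕ) {u : ℝ} (hu : 0 < u) (hu1 : u ≤ 1) :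
    M.NcCount n v * u^v ≤ Real.exp (M.En n * (M.Cparam / 2 * u^2 + K1 M * (u^2)^M.xiexp2)) := by
  obtain ⟨hn0, hE, hc, hv, hw⟩ := hi
  refine (coeff_eval1 (Aprod M _) hu.le v).trans ?_
  rw [eval_prod]
  simp only [eval_pow]
  calc _ ≤ ∏ t, Real.exp (M.A t 2 * u^2 + (∑ i ∈ range (M.s t + 1), (M.A t i : ℝ)) * (u^2)^M.xiexp2) ^ M.cExp n t := by
        refine Finset.prod_le_prod (fun t _ => pow_nonneg (eval_nonneg (Anonneg M t) hu.le) _) fun t _ => ?_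
        exact pow_le_pow_left₀ (eval_nonneg (Anonneg M t) hu.le) (A_eval M hr t hu hu1) _
    _ = _ := by
        simp only [← Real.exp_nat_mul]
        rw [← Real.exp_sum]
        congr 1
        rw [Cparam_eq M hr]
        unfold K1
        simp only [hc]
        rw [mul_div_cancel_left₀ _ (two_ne_zero), Finset.sum_mul, Finset.sum_mul, ← Finset.sum_add_distrib, Finset.mul_sum]
        refine Finset.sum_congr rfl fun t _ => by ring

theorem Nv_ub (hp : M.p = 2) {α : ℝ} {n : ℕ} (hi : Intg M α n) (w v : ℕ) {y z : ℝ} (hy : 0 < y) (hz : 0 < z) (hz1 : z ≤ 1) :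
    M.NvCount n w v * y^w * z^v ≤ Real.exp (M.En n * (M.Pfun y / 2 * z^2 + K2 M y * (z^2)^M.xiexp2)) := by
  obtain ⟨hn0, hE, hc, hv, hw⟩ := hi
  refine (coeff_eval2 (Bprod M _) hy.le hz.le w v).trans ?_
  rw [eval_prod, eval_prod]
  simp only [eval_pow]
  have hnn : ∀ t, 0 ≤ ((M.Bpoly t).eval (C y)).eval z := by
    intro t
    refine le_trans ?_ (coeff_eval2 (Bnonneg M t) hy.le hz.le 0 0)
    rw [Bcoef]; simp
  calc _ ≤ ∏ t, Real.exp ((∑ i ∈ range (M.kdim t + 1), (M.B t i 2 : ℝ) * y^i) * z^2 +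
      (∑ i ∈ range (M.kdim t + 1), ∑ j ∈ range (M.q t + 1), (M.B t i j : ℝ) * y^i) * (z^2)^M.xiexp2) ^ M.vExp n t := by
        refine Finset.prod_le_prod (fun t _ => pow_nonneg (hnn t) _) fun t _ => ?_
        exact pow_le_pow_left₀ (hnn t) (B_eval M hp t hy hz hz1) _
    _ = _ := by
        simp only [← Real.exp_nat_mul]
        rw [← Real.exp_sum]
        congr 1
        rw [← PP_eval M hp]
        unfold K2 PP
        simp only [hv, eval_finsetSum, eval_mul, eval_C, eval_pow, eval_X]
        rw [Finset.sum_div, Finset.sum_mul, Finset.sum_mul, ← Finset.sum_add_distrib, Finset.mul_sum]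
        refine Finset.sum_congr rfl fun t _ => by ring

end Cor4

namespace Cor4
open Filter Polynomial Finset
open scoped Classical
attribute [local instance] polyPO
attribute [local instance] polyOR
variable (M : DGLDPC)

/-- total constant in the upper bound -/
noncomputable def KK (y : ℝ) : ℝ := K1 M * (1 / M.Cparam)^M.xiexp2 + K2 M y * M.Cparam^M.xiexp2 + 1

theorem term_ub (hr : M.r = 2) (hp : M.p = 2) {y : ℝ} (hy : 0 < y) (hPy : M.Pfun y = 1 / M.Cparam)
    {α : ℝ} (hα : 0 < α) {n : ℕ} (hi : Intg M α n) (b : ℝ) (hb : b = (∑ t, M.q t : ℕ) * (α * M.intlam))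
    (h1 : b ≤ 1/2) (h2 : b ≤ M.Cparam) (h3 : b ≤ 1 / M.Cparam) (v : ℕ) :
    M.NvCount n ⌊α * (n:ℝ)⌋₊ v * M.NcCount n v / ((M.En n).choose v : ℝ) * y^⌊α * (n:ℝ)⌋₊ ≤
      (M.En n + 1) * Real.exp (M.En n * (KK M y * b ^ M.xiexp2)) := by
  have hC := Cparam_pos M hr
  have hl := intlam_pos M
  by_cases hNv : M.NvCount n ⌊α * (n:ℝ)⌋₊ v = 0
  · rw [hNv]; simp; positivity
  have hs1 := Nv_supp1 M _ _ _ hNv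
  have hs2 := Nv_supp2 M _ _ _ hNv
  have hi' := hi
  obtain ⟨hn0, hE, _, _, hw⟩ := hi
  set w := ⌊α * (n:ℝ)⌋₊
  set E := M.En n
  have hn0' : (0:ℝ) < n := by exact_mod_cast hn0
  have hE1 : (0:ℝ) < E := by rw [hE]; positivity
  have hw1 : (0:ℝ) < w := by rw [hw]; positivity
  have hv0 : 0 < v := by
    rcases Nat.eq_zero_or_pos v with h | h
    · rw [h, mul_zero] at hs2
      have : w = 0 := by omega
      rw [this] at hw1; simp at hw1
    · exact h
  have hv0' : (0:ℝ) < v := by exact_mod_cast hv0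
  set β : ℝ := v / E with hβ
  have hβ0 : 0 < β := by positivity
  have hβb : β ≤ b := by
    have h1 : (v:ℝ) ≤ (∑ t, M.q t : ℕ) * w := by exact_mod_cast hs1
    have h2 : (w:ℝ) = α * M.intlam * E := by rw [hw, hE]; field_simp
    rw [hβ, div_le_iff₀ hE1, hb]
    rw [h2] at h1
    linarith
  have hβ1 : β ≤ 1/2 := hβb.trans h1
  have hvE : v < E := by
    have : (v:ℝ) = β * E := by rw [hβ]; field_simp
    have : (v:ℝ) < E := by nlinarith
    exact_mod_cast this
  have hvβ : (v:ℝ) = β * E := by rw [hβ]; field_simp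
  set u := Real.sqrt (β / M.Cparam) with hu
  set z := Real.sqrt (β * M.Cparam) with hz
  have hu0 : 0 < u := Real.sqrt_pos.mpr (by positivity)
  have hz0 : 0 < z := Real.sqrt_pos.mpr (by positivity)
  have hu2 : u^2 = β / M.Cparam := Real.sq_sqrt (by positivity)
  have hz2 : z^2 = β * M.Cparam := Real.sq_sqrt (by positivity)
  have hu1 : u ≤ 1 := by
    rw [hu, Real.sqrt_le_one, div_le_one hC]; linarith
  have hz1 : z ≤ 1 := by
    rw [hz, Real.sqrt_le_one]
    have := hβb.trans h3
    rwa [le_div_iff₀ hC] at this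
  have huz : z * u = β := by
    rw [hu, hz, ← Real.sqrt_mul (by positivity)]
    rw [show β * M.Cparam * (β / M.Cparam) = β^2 by field_simp]
    exact Real.sqrt_sq hβ0.le
  have hA := Nc_ub M hr hi' v hu0 hu1
  have hB := Nv_ub M hp hi' w v hy hz0 hz1
  have hmode := choose_mode E v hvE β hβ
  rw [hu2] at hA
  rw [hz2, hPy] at hB
  have hcp : (0:ℝ) < E.choose v := by exact_mod_cast Nat.choose_pos hvE.le
  have hexp : (1-β)^(E-v) ≤ Real.exp (E * (-β + β^2)) := by
    have h5 : 1 - β ≤ Real.exp (-β) := by have := Real.add_one_le_exp (-β); linarith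
    refine (pow_le_pow_left₀ (by linarith) h5 _).trans_eq ?_
    rw [← Real.exp_nat_mul, Nat.cast_sub hvE.le, hvβ]
    congr 1; ring
  have hNv0 := Nv_nonneg M n w v
  have hNc0 := Nc_nonneg M n v
  have hb0 : 0 < b := lt_of_lt_of_le hβ0 hβb
  have hξ0 := xi_nonneg M
  have hξ2 := xi_le2 M
  calc M.NvCount n w v * M.NcCount n v / (E.choose v : ℝ) * y^w
      = M.NvCount n w v * M.NcCount n v / (E.choose v : ℝ) * y^w * 1 := by ring
    _ ≤ M.NvCount n w v * M.NcCount n v / (E.choose v : ℝ) * y^w * ((E + 1) * ((E.choose v : ℝ) * β^v * (1-β)^(E-v))) := by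
        gcongr
    _ = (E+1) * ((M.NvCount n w v * y^w * z^v) * (M.NcCount n v * u^v) * (1-β)^(E-v)) := by
        rw [← huz, mul_pow]; field_simp
    _ ≤ (E+1) * (Real.exp (E * (1 / M.Cparam / 2 * (β * M.Cparam) + K2 M y * (β * M.Cparam) ^ M.xiexp2)) *
        Real.exp (E * (M.Cparam / 2 * (β / M.Cparam) + K1 M * (β / M.Cparam) ^ M.xiexp2)) *
        Real.exp (E * (-β + β^2))) := by
        have : 0 ≤ 1 - β := by linarith
        gcongr
    _ = (E+1) * Real.exp (E * (K2 M y * (β * M.Cparam) ^ M.xiexp2 + K1 M * (β / M.Cparam) ^ M.xiexp2 + β^2)) := by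
        rw [← Real.exp_add, ← Real.exp_add]
        congr 2
        field_simp
        ring
    _ ≤ _ := by
        have k1 := K1_nonneg M
        have k2 := K2_nonneg M hy
        have e1 : (β * M.Cparam) ^ M.xiexp2 ≤ M.Cparam^M.xiexp2 * b^M.xiexp2 := by
          rw [← Real.mul_rpow (by positivity) (by positivity), mul_comm]
          gcongr
        have e2 : (β / M.Cparam) ^ M.xiexp2 ≤ (1 / M.Cparam)^M.xiexp2 * b^M.xiexp2 := by
          rw [← Real.mul_rpow (by positivity) (by positivity), one_div, mul_comm, ← div_eq_mul_inv]
          gcongr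
        have e3 : β^2 ≤ b^M.xiexp2 := by
          calc β^2 ≤ b^2 := by gcongr
            _ = b^(2:ℝ) := by rw [← Real.rpow_natCast]; norm_num
            _ ≤ _ := Real.rpow_le_rpow_of_exponent_ge hb0 (by linarith) hξ2
        gcongr
        unfold KK
        have f1 := mul_le_mul_of_nonneg_left e1 k2
        have f2 := mul_le_mul_of_nonneg_left e2 k1
        linarith

theorem upper (hr : M.r = 2) (hp : M.p = 2) {y : ℝ} (hy : 0 < y) (hPy : M.Pfun y = 1 / M.Cparam)
    {α : ℝ} (hα : 0 < α) {n : ℕ} (hA : M.Adm α n) (b : ℝ) (hb : b = (∑ t, M.q t : ℕ) * (α * M.intlam))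
    (h1 : b ≤ 1/2) (h2 : b ≤ M.Cparam) (h3 : b ≤ 1 / M.Cparam) :
    M.grSeq α n ≤ α * Real.log (1 / y) + KK M y * b ^ M.xiexp2 / M.intlam + errf M n := by
  have hl := intlam_pos M
  obtain ⟨hi, hpos⟩ := (adm_iff M α n).mp hA
  obtain ⟨v, hv, hmax⟩ := ENw_max M n ⌊α * (n:ℝ)⌋₊
  have ht := term_ub M hr hp hy hPy hα hi b hb h1 h2 h3 v
  obtain ⟨hn0, hE, _, _, hw⟩ := hi
  have hn0' : (0:ℝ) < n := by exact_mod_cast hn0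
  have h4 : M.ENw n ⌊α * (n:ℝ)⌋₊ * y^⌊α * (n:ℝ)⌋₊ ≤ (M.En n + 1)^2 * Real.exp (M.En n * (KK M y * b ^ M.xiexp2)) := by
    calc _ ≤ ((M.En n + 1) * (M.NvCount n ⌊α * (n:ℝ)⌋₊ v * M.NcCount n v / ((M.En n).choose v : ℝ))) * y^⌊α * (n:ℝ)⌋₊ := by gcongr
      _ = (M.En n + 1) * ((M.NvCount n ⌊α * (n:ℝ)⌋₊ v * M.NcCount n v / ((M.En n).choose v : ℝ)) * y^⌊α * (n:ℝ)⌋₊) := by ring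
      _ ≤ (M.En n + 1) * ((M.En n + 1) * Real.exp (M.En n * (KK M y * b ^ M.xiexp2))) := by gcongr
      _ = _ := by ring
  have h5 := Real.log_le_log (by positivity) h4
  rw [Real.log_mul hpos.ne' (by positivity), Real.log_mul (by positivity) (by positivity), Real.log_exp,
    Real.log_pow, Real.log_pow, hw] at h5
  unfold DGLDPC.grSeq errf
  generalize Real.log (M.ENw n ⌊α * (n:ℝ)⌋₊) = L at *
  generalize Real.log ((M.En n : ℝ) + 1) = L2 at *
  rw [hE] at h5
  push_cast at h5
  rw [one_div y, Real.log_inv]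
  have e : α * -Real.log y + KK M y * b ^ M.xiexp2 / M.intlam + 2 * L2 / n =
    (1 / n) * (2 * L2 + n / M.intlam * (KK M y * b ^ M.xiexp2) - α * n * Real.log y) := by
    field_simp; ring
  rw [e]
  gcongr
  linarith

theorem Nc_lb (hr : M.r = 2) (n m : ℕ) (θ E : ℝ) (hθ : 0 ≤ θ) (hE : 0 ≤ E)
    (hc : ∀ t, (M.cExp n t : ℝ) = E * M.ρ t / (M.s t : ℝ)) (hm : ∀ t, m ≤ M.cExp n t)
    (hcv : ∀ t, θ * M.cExp n t ≤ M.cExp n t - m) :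
    (θ * E * M.Cparam / 2)^m / m.factorial ≤ M.NcCount n (2 * m) := by
  have h0 : ∀ t, 0 ≤ Polynomial.C (M.A t 2 : ℝ) * X^2 := by
    intro t
    rw [polyLe_iff]; intro i
    rw [coeff_C_mul, coeff_X_pow, coeff_zero]
    split_ifs <;> simp
  have h1 := exp_prod alg1 m Finset.univ (M.cExp n) hm (fun t => θ * M.cExp n t) (fun t => by positivity)
    hcv (fun t => Polynomial.C (M.A t 2 : ℝ) * X^2) h0
  have h2 : (∏ t, (1 + Polynomial.C (M.A t 2 : ℝ) * X^2)^(M.cExp n t)) ≤ ∏ t, M.Apoly t ^ M.cExp n t := by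
    refine Finset.prod_le_prod (fun t _ => pow_nonneg (add_nonneg zero_le_one (h0 t)) _) fun t _ => ?_
    refine pow_le_pow_left₀ (add_nonneg zero_le_one (h0 t)) ?_ _
    rw [polyLe_iff]; intro i
    rw [Acoef, coeff_add, coeff_C_mul, coeff_X_pow, coeff_one]
    split_ifs with g1 g2 g2
    · omega
    · subst g1; simp [M.hA0 t]
    · subst g2; simp
    · simp
  have h3 := (polyLe_iff.mp (h1.trans h2)) (2 * m)
  refine le_trans (le_of_eq ?_) h3
  have e : ∑ t, algebraMap ℝ ℝ[X] (θ * M.cExp n t) * (Polynomial.C (M.A t 2 : ℝ) * X^2) =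
      Polynomial.C (θ * E * M.Cparam / 2) * X^2 := by
    rw [Cparam_eq M hr, Finset.mul_sum, Finset.mul_sum, Finset.sum_div, map_sum, Finset.sum_mul]
    refine Finset.sum_congr rfl fun t _ => ?_
    rw [Polynomial.algebraMap_apply, Algebra.algebraMap_self, RingHom.id_apply, ← mul_assoc, ← C_mul, hc]
    congr 2
    ring
  rw [e, mul_pow, ← pow_mul, ← C_pow, Polynomial.algebraMap_apply, Algebra.algebraMap_self, RingHom.id_apply, ← mul_assoc, ← C_mul,
    coeff_C_mul, coeff_X_pow, if_pos rfl]
  ring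

theorem Nv_lb (n m w : ℕ) (θ E : ℝ) (hθ : 0 ≤ θ) (hE : 0 ≤ E)
    (hc : ∀ t, (M.vExp n t : ℝ) = E * M.lam t / (M.q t : ℝ)) (hm : ∀ t, m ≤ M.vExp n t)
    (hcv : ∀ t, θ * M.vExp n t ≤ M.vExp n t - m) :
    (θ * E / 2)^m / m.factorial * (PP M ^ m).coeff w ≤ M.NvCount n w (2 * m) := by
  set bb : Fin M.nv → ℝ[X] := fun t => ∑ i ∈ range (M.kdim t + 1), Polynomial.C (M.B t i 2 : ℝ) * X^i with hbb
  have hbc : ∀ t i, (bb t).coeff i = M.B t i 2 := by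
    intro t i
    simp only [hbb, finsetSum_coeff, coeff_C_mul, coeff_X_pow, mul_ite, mul_one, mul_zero,
      Finset.sum_ite_eq, Finset.mem_range]
    split_ifs with h
    · rfl
    · rw [M.hBsupp t i 2 (by omega) (by omega)]; simp
  set x : Fin M.nv → ℝ[X][X] := fun t => Polynomial.C (X^2) * (Polynomial.mapRingHom Polynomial.C (bb t)) with hx
  have hxc : ∀ t i j, ((x t).coeff i).coeff j = if j = 2 then (M.B t i 2 : ℝ) else 0 := by
    intro t i j
    simp only [hx]
    rw [coeff_C_mul, coe_mapRingHom, coeff_map, hbc, coeff_mul_C, coeff_X_pow]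
    split_ifs <;> simp
  have h0 : ∀ t, 0 ≤ x t := by
    intro t
    rw [le2]; intro i j
    rw [hxc]
    split_ifs <;> simp
  have h1 := exp_prod alg2 m Finset.univ (M.vExp n) hm (fun t => θ * M.vExp n t) (fun t => by positivity)
    hcv x h0
  have h2 : (∏ t, (1 + x t)^(M.vExp n t)) ≤ ∏ t, M.Bpoly t ^ M.vExp n t := by
    refine Finset.prod_le_prod (fun t _ => pow_nonneg (add_nonneg zero_le_one (h0 t)) _) fun t _ => ?_
    refine pow_le_pow_left₀ (add_nonneg zero_le_one (h0 t)) ?_ _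
    rw [le2]; intro i j
    rw [Bcoef, coeff_add, coeff_add, hxc, coeff_one]
    by_cases g1 : i = 0
    · subst g1
      rw [if_pos rfl, coeff_one]
      split_ifs with g2 g3 g3
      · omega
      · subst g2; simp [M.hB00 t]
      · subst g3; simp
      · simp
    · rw [if_neg g1, coeff_zero, zero_add]
      split_ifs with g2
      · subst g2; simp
      · simp
  have h3 := (le2.mp (h1.trans h2)) w (2 * m)
  refine le_trans (le_of_eq ?_) h3
  have e : ∑ t, algebraMap ℝ ℝ[X][X] (θ * M.vExp n t) * x t =
      Polynomial.C (Polynomial.C (θ * E / 2)) * (Polynomial.C (X^2) * Polynomial.mapRingHom Polynomial.C (PP M)) := by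
    unfold PP
    rw [map_sum, Finset.mul_sum, Finset.mul_sum]
    refine Finset.sum_congr rfl fun t _ => ?_
    change _ = Polynomial.C (Polynomial.C (θ * E / 2)) * (Polynomial.C (X^2) * Polynomial.mapRingHom Polynomial.C (Polynomial.C (2 * (M.lam t / M.q t)) * bb t))
    rw [map_mul (mapRingHom Polynomial.C), Polynomial.algebraMap_apply, Polynomial.algebraMap_apply, Algebra.algebraMap_self, RingHom.id_apply, hc]
    have : θ * (E * M.lam t / M.q t) = (θ * E / 2) * (2 * (M.lam t / M.q t)) := by ring
    rw [this, C_mul, C_mul, coe_mapRingHom, map_C]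
    simp only [hx, coe_mapRingHom]
    ring
  rw [e, mul_pow, mul_pow, ← map_pow (mapRingHom Polynomial.C), ← C_pow, ← C_pow, ← C_pow, ← pow_mul,
    Polynomial.algebraMap_apply, Polynomial.algebraMap_apply, Algebra.algebraMap_self, RingHom.id_apply,
    coeff_C_mul, coeff_C_mul, coeff_C_mul, coeff_C_mul, coeff_C_mul, coe_mapRingHom, coeff_map, coeff_mul_C, coeff_X_pow, if_pos rfl]
  ring

theorem ENw_lb (hr : M.r = 2) {α : ℝ} (hα : 0 < α) {n : ℕ} (hi : Intg M α n) (κ : ℝ) (hκ : 0 < κ)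
    (hκ1 : ∀ t, κ ≤ M.ρ t / M.s t) (hκ2 : ∀ t, κ ≤ M.lam t / M.q t)
    (ha : α * M.intlam ≤ κ / 2) (ha2 : α * M.intlam ≤ 1/2) (m : ℕ) (hm : m ≤ ⌊α * (n:ℝ)⌋₊) :
    (1 - α * M.intlam / κ)^(2 * m) / (2 * m + 1) * (M.Cparam^m * (PP M ^ m).coeff ⌊α * (n:ℝ)⌋₊) ≤
      M.ENw n ⌊α * (n:ℝ)⌋₊ := by
  have hC := Cparam_pos M hr
  have hl := intlam_pos M
  obtain ⟨hn0, hE, hc, hv, hw⟩ := hi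
  have hn0' : (0:ℝ) < n := by exact_mod_cast hn0
  set w := ⌊α * (n:ℝ)⌋₊
  have hE1 : (0:ℝ) < M.En n := by rw [hE]; positivity
  have hwE : (w:ℝ) = α * M.intlam * M.En n := by rw [hw, hE]; field_simp
  set a := α * M.intlam
  have ha0 : 0 < a := by positivity
  have hmw : (m:ℝ) ≤ a * M.En n := by rw [← hwE]; exact_mod_cast hm
  set θ := 1 - a / κ with hθ
  have haκ : a / κ ≤ 1/2 := by rw [div_le_iff₀ hκ]; linarith
  have hθ0 : 0 ≤ θ := by rw [hθ]; linarith
  have gen : ∀ (N : ℕ) (g : ℝ), κ ≤ g → (N:ℝ) = M.En n * g → m ≤ N ∧ θ * N ≤ N - m := by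
    intro N g hg hN
    constructor
    · have : (m:ℝ) ≤ N := by rw [hN]; nlinarith
      exact_mod_cast this
    · have h1 : a ≤ a / κ * g := by
        calc a = a / κ * κ := by field_simp
          _ ≤ _ := by gcongr
      have h2 := mul_le_mul_of_nonneg_right h1 hE1.le
      rw [hθ, hN]
      nlinarith
  have gc := fun t => gen (M.cExp n t) _ (hκ1 t) (by rw [hc]; ring)
  have gv := fun t => gen (M.vExp n t) _ (hκ2 t) (by rw [hv]; ring)
  have hNc := Nc_lb M hr n m θ (M.En n) hθ0 hE1.le hc (fun t => (gc t).1) (fun t => (gc t).2)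
  have hNv := Nv_lb M n m w θ (M.En n) hθ0 hE1.le hv (fun t => (gv t).1) (fun t => (gv t).2)
  have h2m : 2 * m ≤ M.En n := by
    have : (2 * m : ℝ) ≤ M.En n := by nlinarith
    exact_mod_cast this
  refine le_trans ?_ (ENw_ge M n w (2 * m) h2m)
  have hcp : (0:ℝ) < (M.En n).choose (2 * m) := by exact_mod_cast Nat.choose_pos h2m
  rw [le_div_iff₀ hcp]
  have hch : ((M.En n).choose (2 * m) : ℝ) ≤ (M.En n : ℝ)^(2*m) / (2*m).factorial := Nat.choose_le_pow_div _ _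
  have hp0 : 0 ≤ (PP M ^ m).coeff w := (pow_nonneg (PP_nonneg M) m) w
  set P := (PP M ^ m).coeff w
  have h4 : (4:ℝ)^m * (m.factorial * m.factorial) ≤ (2 * m + 1) * (2*m).factorial := by
    have h5 := Nat.four_pow_le_two_mul_add_one_mul_central_binom m
    have h6 := Nat.choose_mul_factorial_mul_factorial (show m ≤ 2 * m by omega)
    rw [show 2 * m - m = m by omega] at h6
    have h7 : 4^m * (m.factorial * m.factorial) ≤ (2 * m + 1) * (2*m).factorial := by
      rw [← h6]
      calc _ ≤ (2 * m + 1) * (2*m).choose m * (m.factorial * m.factorial) := Nat.mul_le_mul_right _ h5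
        _ = _ := by ring
    exact_mod_cast h7
  refine le_trans ?_ (mul_le_mul hNv hNc (by positivity) (Nv_nonneg M _ _ _))
  calc θ^(2 * m) / (2 * m + 1) * (M.Cparam^m * P) * ((M.En n).choose (2 * m) : ℝ)
      ≤ θ^(2 * m) / (2 * m + 1) * (M.Cparam^m * P) * ((M.En n : ℝ)^(2*m) / (2*m).factorial) := by gcongr
    _ = (θ^(2*m) * (M.Cparam^m * P) * (M.En n : ℝ)^(2*m)) * (1 / ((2 * m + 1) * (2*m).factorial)) := by field_simp
    _ ≤ (θ^(2*m) * (M.Cparam^m * P) * (M.En n : ℝ)^(2*m)) * (1 / ((4:ℝ)^m * (m.factorial * m.factorial))) := by gcongr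
    _ = _ := by
      have : (4:ℝ)^m = 2^m * 2^m := by rw [← mul_pow]; norm_num
      rw [this]
      simp only [div_pow, mul_pow]
      field_simp
      ring

theorem coeff_pow_le {p : ℝ[X]} (hp : 0 ≤ p) (j k : ℕ) : p.coeff j ^ k ≤ (p^k).coeff (j * k) := by
  induction k with
  | zero => simp
  | succ k ih =>
    rw [pow_succ, pow_succ, Nat.mul_succ]
    refine le_trans ?_ (coeff_mul_le1 (pow_nonneg hp k) hp _ _)
    exact mul_le_mul_of_nonneg_right ih (hp j)

theorem exists_j (hr : M.r = 2) (hp : M.p = 2) {y : ℝ} (hy : 0 < y) (hPy : M.Pfun y = 1 / M.Cparam) (m : ℕ) :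
    ∃ j, m ≤ j ∧ 1 / (((PP M).natDegree : ℝ) * m + 1) ≤ (PP M ^ m).coeff j * (M.Cparam^m * y^j) := by
  have hC := Cparam_pos M hr
  set D := (PP M).natDegree
  have hsum : ∑ j ∈ range (D * m + 1), (PP M ^ m).coeff j * (M.Cparam^m * y^j) = 1 := by
    have h1 : (PP M ^ m).eval y = ∑ j ∈ range (D * m + 1), (PP M ^ m).coeff j * y^j := by
      rw [eval_eq_sum_range' (n := D * m + 1)]
      have h0 : (PP M ^ m).natDegree ≤ m * D := natDegree_pow_le
      rw [mul_comm] at h0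
      omega
    rw [eval_pow, PP_eval M hp, hPy] at h1
    calc _ = M.Cparam^m * ∑ j ∈ range (D * m + 1), (PP M ^ m).coeff j * y^j := by
          rw [Finset.mul_sum]; exact Finset.sum_congr rfl fun _ _ => by ring
      _ = 1 := by rw [← h1, ← mul_pow, mul_one_div_cancel hC.ne', one_pow]
  have hpos : (0:ℝ) < (D:ℝ) * m + 1 := by positivity
  obtain ⟨j, hj, hle⟩ : ∃ j ∈ range (D * m + 1), 1 / ((D : ℝ) * m + 1) ≤ (PP M ^ m).coeff j * (M.Cparam^m * y^j) := by
    apply Finset.exists_le_of_sum_le (by simp)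
    rw [hsum, Finset.sum_const, card_range, nsmul_eq_mul]
    push_cast
    rw [mul_one_div_cancel hpos.ne']
  refine ⟨j, ?_, hle⟩
  by_contra hlt
  push Not at hlt
  have hX : X^m ∣ PP M ^ m := pow_dvd_pow_of_dvd (X_dvd_iff.mpr (PP_zero M)) m
  rw [X_pow_dvd_iff.mp hX j hlt, zero_mul] at hle
  have : 0 < 1 / ((D : ℝ) * m + 1) := by positivity
  linarith

theorem lower_fin {n m j w : ℕ} {α L1 L3 Ly L : ℝ} (hn0' : (0:ℝ) < n) (hm0' : (0:ℝ) < m) (hj0' : (0:ℝ) < j)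
    (hmj' : (m:ℝ) ≤ j) (hα : 0 < α) (hw0 : (0:ℝ) < w) (hw : (w:ℝ) = α * n)
    (hlog : 2 * ((m * w : ℕ) : ℝ) * L1 - Real.log (2 * (m * w : ℕ) + 1) + w * -L3 ≤ L + (j * w : ℕ) * Ly)
    (l1 : L1 ≤ 0) (l3 : 0 ≤ L3) :
    α * -Ly + 2 * α * L1 - Real.log (2 * α * (j * n : ℕ) + 1) / (j * n : ℕ) - α * (L3 / m) ≤ 1 / ((j * n : ℕ) : ℝ) * L := by
  have hmw : (m:ℝ) * w ≤ j * w := by gcongr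
  have l2 : Real.log (2 * (m * w : ℕ) + 1) ≤ Real.log (2 * α * (j * n : ℕ) + 1) := by
    apply Real.log_le_log (by positivity)
    push_cast
    have : 2 * α * ((j:ℝ) * n) = 2 * (j * w) := by rw [hw]; ring
    rw [this]
    linarith
  push_cast at hlog l2 ⊢
  generalize Real.log (2 * ((m:ℝ) * w) + 1) = L2 at hlog l2
  generalize Real.log (2 * α * ((j:ℝ) * n) + 1) = L2' at l2 ⊢
  have l4 : w * L3 / (j * n) ≤ α * (L3 / m) := by
    rw [hw]
    rw [show α * n * L3 / (j * n) = α * (L3 / j) by field_simp]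
    gcongr
  have l5 : 2 * (j * w) * L1 ≤ (2 * (m * w) : ℝ) * L1 :=
    mul_le_mul_of_nonpos_right (by linarith) l1
  have hfin : 2 * (j * w) * L1 - L2' - w * L3 - j * w * Ly ≤ L := by linarith
  have h9 : 1 / (j * n : ℝ) * (2 * (j * w) * L1 - L2' - w * L3 - j * w * Ly) ≤ 1 / (j * n : ℝ) * L := by gcongr
  have e9 : 1 / (j * n : ℝ) * (2 * (j * w) * L1 - L2' - w * L3 - j * w * Ly) =
     2 * α * L1 - L2' / (j * n) - w * L3 / (j * n) - α * Ly := by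
    rw [hw]; field_simp
  linarith

theorem lower (hr : M.r = 2) (hp : M.p = 2) {y : ℝ} (hy : 0 < y) (hPy : M.Pfun y = 1 / M.Cparam)
    {α : ℝ} (hα : 0 < α) {n : ℕ} (hi : Intg M α n) (κ : ℝ) (hκ : 0 < κ)
    (hκ1 : ∀ t, κ ≤ M.ρ t / M.s t) (hκ2 : ∀ t, κ ≤ M.lam t / M.q t)
    (ha : α * M.intlam ≤ κ / 2) (ha2 : α * M.intlam ≤ 1/2) (m : ℕ) (hm : 0 < m) :
    ∃ N, m ≤ N ∧ M.Adm α N ∧ α * Real.log (1 / y) + 2 * α * Real.log (1 - α * M.intlam / κ)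
      - Real.log (2 * α * N + 1) / N - α * (Real.log (((PP M).natDegree : ℝ) * m + 1) / m) ≤ M.grSeq α N := by
  have hC := Cparam_pos M hr
  have hl := intlam_pos M
  obtain ⟨j, hmj, hj⟩ := exists_j M hr hp hy hPy m
  have hj0 : 0 < j := by omega
  have hi1 := intg_mul M hi j hj0
  obtain ⟨hn0, _, _, _, hw⟩ := id hi
  obtain ⟨hN0, _, _, _, hW⟩ := id hi1
  set w := ⌊α * (n:ℝ)⌋₊
  have hn0' : (0:ℝ) < n := by exact_mod_cast hn0
  have hw0 : (0:ℝ) < w := by rw [hw]; positivity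
  have hWeq : ⌊α * ((j * n : ℕ) : ℝ)⌋₊ = j * w := by
    have : (⌊α * ((j * n : ℕ) : ℝ)⌋₊ : ℝ) = ((j * w : ℕ) : ℝ) := by
      rw [hW]; push_cast; rw [hw]; ring
    exact_mod_cast this
  have hlb := ENw_lb M hr hα hi1 κ hκ hκ1 hκ2 ha ha2 (m * w) (by rw [hWeq]; exact Nat.mul_le_mul_right _ hmj)
  rw [hWeq] at hlb
  have haκ : α * M.intlam / κ ≤ 1/2 := by rw [div_le_iff₀ hκ]; linarith
  set θ := 1 - α * M.intlam / κ with hθ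
  have hθ0 : 0 < θ := by rw [hθ]; linarith
  have hθ1 : θ ≤ 1 := by
    rw [hθ]
    have : 0 < α * M.intlam / κ := by positivity
    linarith
  set D := (PP M).natDegree
  have hD : (0:ℝ) < (D:ℝ) * m + 1 := by positivity
  have hcp := coeff_pow_le (pow_nonneg (PP_nonneg M) m) j w
  rw [← pow_mul] at hcp
  have hmain : θ^(2 * (m * w)) / (2 * (m * w : ℕ) + 1) * (1 / ((D:ℝ) * m + 1))^w ≤ M.ENw (j * n) (j * w) * y^(j*w) := by
    calc _ ≤ θ^(2 * (m * w)) / (2 * (m * w : ℕ) + 1) * ((PP M ^ m).coeff j * (M.Cparam^m * y^j))^w := by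
          gcongr
      _ = θ^(2 * (m * w)) / (2 * (m * w : ℕ) + 1) * (M.Cparam^(m * w) * ((PP M ^ m).coeff j)^w) * y^(j*w) := by
          rw [mul_pow, mul_pow, pow_mul M.Cparam, pow_mul y]; ring
      _ ≤ θ^(2 * (m * w)) / (2 * (m * w : ℕ) + 1) * (M.Cparam^(m * w) * ((PP M ^ (m * w)).coeff (j * w))) * y^(j*w) := by
          gcongr
      _ ≤ _ := by gcongr
  have hpos : 0 < M.ENw (j * n) (j * w) := by
    have h0 : 0 < θ^(2 * (m * w)) / (2 * (m * w : ℕ) + 1) * (1 / ((D:ℝ) * m + 1))^w := by positivity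
    exact pos_of_mul_pos_left (h0.trans_le hmain) (by positivity)
  refine ⟨j * n, ?_, ?_, ?_⟩
  · exact hmj.trans (Nat.le_mul_of_pos_right _ hn0)
  · rw [adm_iff, hWeq]; exact ⟨hi1, hpos⟩
  unfold DGLDPC.grSeq
  rw [hWeq]
  have hlog := Real.log_le_log (by positivity) hmain
  rw [Real.log_mul (by positivity) (by positivity), Real.log_div (by positivity) (by positivity), Real.log_pow,
    Real.log_pow, Real.log_mul hpos.ne' (by positivity), Real.log_pow, one_div, Real.log_inv] at hlog
  rw [one_div y, Real.log_inv]
  have hmj' : (m:ℝ) ≤ j := by exact_mod_cast hmj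
  have hm0' : (0:ℝ) < m := by exact_mod_cast hm
  have hj0' : (0:ℝ) < j := by exact_mod_cast hj0
  exact lower_fin hn0' hm0' hj0' hmj' hα hw0 hw (by
    rw [Nat.cast_mul, Nat.cast_ofNat] at hlog
    exact hlog) (Real.log_nonpos hθ0.le hθ1) (Real.log_nonneg (by
    have : 0 ≤ (D:ℝ) * m := by positivity
    linarith))

end Cor4

namespace Cor4
open Filter Polynomial Finset
open scoped Classical
variable (M : DGLDPC)

theorem exists_min_pos {k : ℕ} (f : Fin k → ℝ) (hf : ∀ t, 0 < f t) : ∃ κ : ℝ, 0 < κ ∧ ∀ t, κ ≤ f t := by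
  rcases isEmpty_or_nonempty (Fin k) with h | h
  · exact ⟨1, one_pos, fun t => h.elim t⟩
  · obtain ⟨t, ht⟩ := Finite.exists_min f
    exact ⟨f t, hf t, ht⟩

theorem KK_pos (hr : M.r = 2) {y : ℝ} (hy : 0 < y) : 0 < KK M y := by
  have hC := Cparam_pos M hr
  have h1 := K1_nonneg M
  have h2 := K2_nonneg M hy
  unfold KK
  positivity

theorem exists_G (hr : M.r = 2) (hp : M.p = 2) {y : ℝ} (hy : 0 < y) (hPy : M.Pfun y = 1 / M.Cparam)
    {α : ℝ} (hα : 0 < α) (hinf : {n : ℕ | M.Adm α n}.Infinite)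
    (hα1 : α * M.intlam * (∑ t, M.q t : ℕ) < 1)
    (b : ℝ) (hb : b = (∑ t, M.q t : ℕ) * (α * M.intlam))
    (h1 : b ≤ 1/2) (h2 : b ≤ M.Cparam) (h3 : b ≤ 1 / M.Cparam)
    (κ : ℝ) (hκ : 0 < κ)
    (hκ1 : ∀ t, κ ≤ M.ρ t / M.s t) (hκ2 : ∀ t, κ ≤ M.lam t / M.q t)
    (ha : α * M.intlam ≤ κ / 2) (ha2 : α * M.intlam ≤ 1/2) :
    ∃ G : ℝ, Tendsto (M.grSeq α) (atTop ⊓ principal {n : ℕ | M.Adm α n}) (nhds G) ∧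
      G ≤ α * Real.log (1 / y) + KK M y * b^M.xiexp2 / M.intlam ∧
      α * Real.log (1 / y) + 2 * α * Real.log (1 - α * M.intlam / κ) ≤ G := by
  have hup : ∀ n ∈ {n : ℕ | M.Adm α n}, M.grSeq α n ≤ α * Real.log (1 / y) + KK M y * b^M.xiexp2 / M.intlam + errf M n :=
    fun n hn => upper M hr hp hy hPy hα hn b hb h1 h2 h3
  have het := errf_tendsto M
  obtain ⟨Be, hBe⟩ := het.bddAbove_range
  have hBe' : ∀ n, errf M n ≤ Be := fun n => hBe ⟨n, rfl⟩
  obtain ⟨G, hG, hGl⟩ := fekete {n : ℕ | M.Adm α n} hinf (M.grSeq α) (errf M)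
    (α * Real.log (1 / y) + KK M y * b^M.xiexp2 / M.intlam + Be)
    (fun n hn => (hup n hn).trans (by linarith [hBe' n])) (errf_nonneg M) het
    (fun n₁ h₁ ε hε => fek_step M α hα hα1 n₁ h₁ ε hε)
  refine ⟨G, hG, ?_, ?_⟩
  · have hne : (atTop ⊓ principal {n : ℕ | M.Adm α n}).NeBot := by
      rw [← frequently_mem_iff_neBot]
      exact Nat.frequently_atTop_iff_infinite.mpr hinf
    have hlim : Tendsto (fun n => α * Real.log (1 / y) + KK M y * b^M.xiexp2 / M.intlam + errf M n)
        (atTop ⊓ principal {n : ℕ | M.Adm α n}) (nhds (α * Real.log (1 / y) + KK M y * b^M.xiexp2 / M.intlam + 0)) :=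
      (het.mono_left inf_le_left).const_add _
    rw [add_zero] at hlim
    refine le_of_tendsto_of_tendsto hG hlim ?_
    exact eventually_inf_principal.mpr (Eventually.of_forall hup)
  · obtain ⟨n0, hn0⟩ := hinf.nonempty
    have hi := ((adm_iff M α n0).mp hn0).1
    have hlow := fun m : ℕ => lower M hr hp hy hPy hα hi κ hκ hκ1 hκ2 ha ha2 (m + 1) (Nat.succ_pos m)
    choose N hN hNA hNle using hlow
    have hNt : Tendsto N atTop atTop :=
      tendsto_atTop_mono (fun m => (Nat.le_succ m).trans (hN m)) tendsto_id
    have t1 := (log_lin (2 * α) (by positivity)).comp hNt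
    have t2 := ((log_lin ((PP M).natDegree : ℝ) (by positivity)).comp (tendsto_add_atTop_nat 1)).const_mul α
    have t3 := het.comp hNt
    have t4 := ((tendsto_const_nhds (x := α * Real.log (1 / y) + 2 * α * Real.log (1 - α * M.intlam / κ))).sub t1).sub t2 |>.sub t3
    rw [mul_zero, sub_zero, sub_zero, sub_zero] at t4
    refine le_of_tendsto t4 (Eventually.of_forall fun m => ?_)
    have h8 := hNle m
    have h9 := hGl (N m) (hNA m)
    simp only [Function.comp] at *
    linarith

end Cor4

/-- **Corollary 4.** For a D-GLDPC ensemble with `r = p = 2`, the growth rate of the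
weight distribution satisfies `G(α) = α log(1/P⁻¹(1/C)) + O(α^ξ)`, where
`ξ = min { r̄/2, p̄/2, 2 }`.  Here `y = P⁻¹(1/C)` is encoded as the unique nonnegative
solution of `P(y) = 1/C`. -/
theorem cor4_r2_p2 (M : DGLDPC) (hr : M.r = 2) (hp : M.p = 2) :
    ∃ y : ℝ, (0 ≤ y ∧ M.Pfun y = 1 / M.Cparam ∧
        ∀ y' : ℝ, 0 ≤ y' → M.Pfun y' = 1 / M.Cparam → y' = y) ∧
      ∃ k : ℝ, 0 < k ∧ ∃ ε : ℝ, 0 < ε ∧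
        ∀ α : ℝ, 0 < α → α ≤ ε → {n : ℕ | M.Adm α n}.Infinite →
          ∃ G : ℝ,
            Filter.Tendsto (M.grSeq α)
              (Filter.atTop ⊓ Filter.principal {n : ℕ | M.Adm α n}) (nhds G) ∧
            |G - α * Real.log (1 / y)| ≤ k * α ^ M.xiexp2 := by
  obtain ⟨y, hy, hPy, huniq⟩ := Cor4.exists_y M hr hp
  have hC := Cor4.Cparam_pos M hr
  have hl := Cor4.intlam_pos M
  refine ⟨y, ⟨hy.le, hPy, huniq⟩, ?_⟩
  obtain ⟨κ1, hκ1p, hκ1⟩ := Cor4.exists_min_pos (fun t => M.ρ t / M.s t)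
    (fun t => div_pos (M.hρpos t) (Cor4.spos M t))
  obtain ⟨κ2, hκ2p, hκ2⟩ := Cor4.exists_min_pos (fun t => M.lam t / M.q t)
    (fun t => div_pos (M.hlampos t) (Cor4.qpos M t))
  obtain ⟨κ, hκ, hκa, hκb⟩ : ∃ κ : ℝ, 0 < κ ∧ κ ≤ κ1 ∧ κ ≤ κ2 :=
    ⟨min κ1 κ2, lt_min hκ1p hκ2p, min_le_left _ _, min_le_right _ _⟩
  obtain ⟨μ, hμ, m1, m2, m3, m4⟩ : ∃ μ : ℝ, 0 < μ ∧ μ ≤ 1/2 ∧ μ ≤ M.Cparam ∧ μ ≤ 1 / M.Cparam ∧ μ ≤ κ / 2 := by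
    refine ⟨min (min (1/2) M.Cparam) (min (1 / M.Cparam) (κ/2)), ?_, ?_, ?_, ?_, ?_⟩
    · have : 0 < 1 / M.Cparam := by positivity
      refine lt_min (lt_min (by norm_num) hC) (lt_min this (by linarith))
    · exact (min_le_left _ _).trans (min_le_left _ _)
    · exact (min_le_left _ _).trans (min_le_right _ _)
    · exact (min_le_right _ _).trans (min_le_left _ _)
    · exact (min_le_right _ _).trans (min_le_right _ _)
  obtain ⟨Q, hQ⟩ : ∃ Q : ℝ, Q = ((∑ t, M.q t : ℕ) : ℝ) := ⟨_, rfl⟩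
  have hQ0 : 0 ≤ Q := by rw [hQ]; positivity
  have hKK := Cor4.KK_pos M hr hy
  have hk1 : 0 ≤ Cor4.KK M y / M.intlam * (Q * M.intlam) ^ M.xiexp2 := by positivity
  have hk2 : 0 < 4 * M.intlam / κ := by positivity
  refine ⟨Cor4.KK M y / M.intlam * (Q * M.intlam) ^ M.xiexp2 + 4 * M.intlam / κ, by linarith,
    min 1 (μ / (M.intlam * (Q + 1))), by positivity, ?_⟩
  intro α hα hαε hinf
  have hα1 : α ≤ 1 := hαε.trans (min_le_left _ _)
  have hα2 : α * (M.intlam * (Q + 1)) ≤ μ := by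
    rw [← le_div_iff₀ (by positivity)]
    exact hαε.trans (min_le_right _ _)
  have ha0 : 0 < α * M.intlam := by positivity
  have hbμ : Q * (α * M.intlam) ≤ μ := by
    have : α * (M.intlam * (Q + 1)) = Q * (α * M.intlam) + α * M.intlam := by ring
    linarith
  have haμ : α * M.intlam ≤ μ := by
    have h1 : α * (M.intlam * (Q + 1)) = Q * (α * M.intlam) + α * M.intlam := by ring
    have h2 : 0 ≤ Q * (α * M.intlam) := by positivity
    linarith
  obtain ⟨G, hG, hGu, hGl⟩ := Cor4.exists_G M hr hp hy hPy hα hinf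
    (by rw [← hQ, mul_comm]; linarith) (Q * (α * M.intlam)) (by rw [hQ])
    (by linarith) (by linarith) (by linarith) κ hκ (fun t => hκa.trans (hκ1 t))
    (fun t => hκb.trans (hκ2 t)) (by linarith) (by linarith)
  refine ⟨G, hG, ?_⟩
  have hαξ : 0 < α ^ M.xiexp2 := Real.rpow_pos_of_pos hα _
  have hbξ : (Q * (α * M.intlam)) ^ M.xiexp2 = (Q * M.intlam) ^ M.xiexp2 * α ^ M.xiexp2 := by
    rw [← Real.mul_rpow (by positivity) hα.le]
    congr 1
    ring
  have hsq : α ^ 2 ≤ α ^ M.xiexp2 := by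
    rw [← Real.rpow_natCast α 2]
    exact Real.rpow_le_rpow_of_exponent_ge hα hα1 (by exact_mod_cast Cor4.xi_le2 M)
  have hx : α * M.intlam / κ ≤ 1/2 := by rw [div_le_iff₀ hκ]; linarith
  have hx0 : 0 ≤ α * M.intlam / κ := by positivity
  have hlog : -(2 * (α * M.intlam / κ)) ≤ Real.log (1 - α * M.intlam / κ) := by
    generalize α * M.intlam / κ = x at hx hx0
    have h1 : 0 < 1 - x := by linarith
    refine le_trans ?_ (Real.one_sub_inv_le_log_of_pos h1)
    have h2 : (1 - x)⁻¹ ≤ 1 + 2 * x := by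
      rw [inv_le_iff_one_le_mul₀ h1]
      nlinarith
    linarith
  have hl2 : -(4 * M.intlam / κ * α ^ 2) ≤ 2 * α * Real.log (1 - α * M.intlam / κ) := by
    calc -(4 * M.intlam / κ * α ^ 2) = 2 * α * (-(2 * (α * M.intlam / κ))) := by ring
      _ ≤ _ := by gcongr
  have hl3 : 4 * M.intlam / κ * α ^ 2 ≤ 4 * M.intlam / κ * α ^ M.xiexp2 := by gcongr
  have hk3 : 0 ≤ Cor4.KK M y / M.intlam * (Q * M.intlam) ^ M.xiexp2 * α ^ M.xiexp2 := by positivity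
  have hk4 : 0 ≤ 4 * M.intlam / κ * α ^ M.xiexp2 := by positivity
  have hu : Cor4.KK M y * (Q * (α * M.intlam)) ^ M.xiexp2 / M.intlam =
      Cor4.KK M y / M.intlam * (Q * M.intlam) ^ M.xiexp2 * α ^ M.xiexp2 := by
    rw [hbξ]; ring
  rw [hu] at hGu
  rw [add_mul, abs_le]
  constructor <;> linarith
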